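/- As q → ∞ through positive integers, Σ_{χ mod q, χ(−1)=−1} |L(1,χ)|^{−2} = (ζ(2)/(2ζ(4))) · ∏_{p | q} (1 + p^{−2})^{−1} · φ(q) · (1 + o(1)); that is, the negative square moment over odd Dirichlet characters modulo q is asymptotic to (ζ(2)/(2ζ(4))) ∏_{p | q} (1 + p^{−2})^{−1} φ(q). -/

import Mathlib

open Complex DirichletCharacter

/-- Partial sums of a character. -/
noncomputable def nsmS {q : ℕ} (χ : DirichletCharacter ℂ q) (n : ℕ) : ℂ :=
  ∑ k ∈ Finset.range n, χ ((k + 1 : ℕ) : ZMod q)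

lemma nsm_sum_range_zmod (q : ℕ) [NeZero q] (g : ZMod q → ℂ) :
    ∑ k ∈ Finset.range q, g (k : ZMod q) = ∑ x : ZMod q, g x := by
  refine Finset.sum_bij' (fun k _ => (k : ZMod q)) (fun x _ => x.val) ?_ ?_ ?_ ?_ ?_
  · intros; simp
  · intro x _; simpa using x.val_lt
  · intro k hk; simp at hk; simp [ZMod.val_natCast, Nat.mod_eq_of_lt hk]
  · intro x _; simp
  · intros; rfl

lemma nsmS_period {q : ℕ} [NeZero q] {χ : DirichletCharacter ℂ q} (hχ : χ ≠ 1) (n : ℕ) :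
    nsmS χ (n + q) = nsmS χ n := by
  unfold nsmS
  rw [Finset.sum_range_add]
  have h1 : ∑ x ∈ Finset.range q, χ ((n + x + 1 : ℕ) : ZMod q) = 0 := by
    have := nsm_sum_range_zmod q (fun x => χ (x + (n + 1 : ℕ)))
    have e2 : ∑ x : ZMod q, χ (x + (n + 1 : ℕ)) = ∑ x : ZMod q, χ x :=
      Fintype.sum_equiv (Equiv.addRight ((n + 1 : ℕ) : ZMod q)) _ (fun x => χ x) (fun x => rfl)
    rw [e2, MulChar.sum_eq_zero_of_ne_one hχ] at this
    rw [← this]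
    refine Finset.sum_congr rfl fun x _ => ?_
    congr 1
    push_cast; ring
  rw [h1, add_zero]

lemma nsmS_le_self {q : ℕ} [NeZero q] (χ : DirichletCharacter ℂ q) (n : ℕ) :
    ‖nsmS χ n‖ ≤ n := by
  unfold nsmS
  refine (norm_sum_le _ _).trans ?_
  refine (Finset.sum_le_sum fun k _ => χ.norm_le_one _).trans ?_
  simp

lemma nsmS_le_q {q : ℕ} [NeZero q] {χ : DirichletCharacter ℂ q} (hχ : χ ≠ 1) (n : ℕ) :
    ‖nsmS χ n‖ ≤ q := by
  have hq : 0 < q := Nat.pos_of_ne_zero (NeZero.ne q)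
  induction n using Nat.strong_induction_on with
  | _ n ih =>
    by_cases h : n ≤ q
    · exact (nsmS_le_self χ n).trans (by exact_mod_cast h)
    · obtain ⟨m, rfl⟩ : ∃ m, n = m + q := ⟨n - q, by omega⟩
      rw [nsmS_period hχ]
      exact ih m (by omega)

lemma nsm_cpow_diff (n : ℕ) (s : ℂ) (hs : 0 < s.re) :
    ‖((n + 1 : ℕ) : ℂ) ^ (-s) - ((n + 1 + 1 : ℕ) : ℂ) ^ (-s)‖ ≤ ‖s‖ * ((n + 1 : ℕ) : ℝ) ^ (-(s.re + 1)) := by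
  have h := Convex.norm_image_sub_le_of_norm_hasDerivWithin_le (𝕜 := ℝ) (f := fun t : ℝ => (t : ℂ) ^ (-s))
    (f' := fun t : ℝ => (-s) * (t : ℂ) ^ (-s - 1)) (s := Set.Icc ((n + 1 : ℕ) : ℝ) ((n + 1 + 1 : ℕ) : ℝ))
    (x := ((n + 1 + 1: ℕ) : ℝ)) (y := ((n + 1 : ℕ) : ℝ)) (C := ‖s‖ * ((n + 1 : ℕ) : ℝ) ^ (-(s.re + 1)))
    ?_ ?_ (convex_Icc _ _) ?_ ?_
  · simpa using h
  · intro x hx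
    have hx0 : 0 < x := lt_of_lt_of_le (by positivity) hx.1
    have hs0 : -s ≠ 0 := by
      intro h
      have := congrArg Complex.re h
      simp at this
      linarith
    exact (hasDerivAt_ofReal_cpow_const (x := x) (r := -s) hx0.ne' hs0).hasDerivWithinAt
  · intro x hx
    have hx0 : 0 < x := lt_of_lt_of_le (by positivity) hx.1
    rw [norm_mul, norm_neg, Complex.norm_cpow_eq_rpow_re_of_pos hx0]
    gcongr ‖s‖ * ?_
    simp only [sub_re, neg_re, one_re]
    rw [show -s.re - 1 = -(s.re + 1) by ring]
    exact Real.rpow_le_rpow_of_nonpos (by positivity) hx.1 (by linarith)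
  · simp
  · simp

/-- terms of the Abel-summed series -/
noncomputable def nsmT {q : ℕ} (χ : DirichletCharacter ℂ q) (s : ℂ) (n : ℕ) : ℂ :=
  nsmS χ (n + 1) * (((n + 1 : ℕ) : ℂ) ^ (-s) - ((n + 1 + 1 : ℕ) : ℂ) ^ (-s))

lemma nsmS_le {q : ℕ} [NeZero q] {χ : DirichletCharacter ℂ q} (hχ : χ ≠ 1) (n : ℕ) {θ : ℝ}
    (h0 : 0 ≤ θ) (h1 : θ ≤ 1) :
    ‖nsmS χ (n + 1)‖ ≤ (q : ℝ) ^ θ * ((n + 1 : ℕ) : ℝ) ^ (1 - θ) := by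
  have e : ‖nsmS χ (n + 1)‖ = ‖nsmS χ (n + 1)‖ ^ θ * ‖nsmS χ (n + 1)‖ ^ (1 - θ) := by
    rw [← Real.rpow_add_of_nonneg (norm_nonneg _) h0 (by linarith)]; simp
  rw [e]
  gcongr
  · exact nsmS_le_q hχ _
  · exact nsmS_le_self χ _

lemma nsmT_le {q : ℕ} [NeZero q] {χ : DirichletCharacter ℂ q} (hχ : χ ≠ 1) (n : ℕ) {θ : ℝ}
    (h0 : 0 ≤ θ) (h1 : θ ≤ 1) {s : ℂ} (hs : 0 < s.re) :
    ‖nsmT χ s n‖ ≤ ‖s‖ * (q : ℝ) ^ θ * ((n + 1 : ℕ) : ℝ) ^ (-(s.re + θ)) := by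
  unfold nsmT
  rw [norm_mul]
  refine (mul_le_mul (nsmS_le hχ n h0 h1) (nsm_cpow_diff n s hs) (norm_nonneg _) (by positivity)).trans ?_
  have : ((n + 1 : ℕ) : ℝ) ^ (-(s.re + θ)) = ((n + 1 : ℕ) : ℝ) ^ (1 - θ) * ((n + 1 : ℕ) : ℝ) ^ (-(s.re + 1)) := by
    rw [← Real.rpow_add (by positivity)]; ring_nf
  rw [this]
  apply le_of_eq; ring

lemma nsm_abel {q : ℕ} (χ : DirichletCharacter ℂ q) (s : ℂ) (N : ℕ) :
    ∑ n ∈ Finset.range N, χ ((n + 1 : ℕ) : ZMod q) * ((n + 1 : ℕ) : ℂ) ^ (-s) =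
      nsmS χ N * ((N + 1 : ℕ) : ℂ) ^ (-s) + ∑ n ∈ Finset.range N, nsmT χ s n := by
  induction N with
  | zero => simp [nsmS]
  | succ N ih =>
    rw [Finset.sum_range_succ, Finset.sum_range_succ, ih]
    have : nsmS χ (N + 1) = nsmS χ N + χ ((N + 1 : ℕ) : ZMod q) := by
      simp [nsmS, Finset.sum_range_succ]
    unfold nsmT
    rw [this]
    ring

lemma nsm_summable_shift {a : ℝ} (ha : 1 < a) : Summable fun n : ℕ => ((n + 1 : ℕ) : ℝ) ^ (-a) := by
  have := (Real.summable_nat_rpow (p := -a)).2 (by linarith)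
  exact (summable_nat_add_iff 1).2 this

lemma nsm_summable_T {q : ℕ} [NeZero q] {χ : DirichletCharacter ℂ q} (hχ : χ ≠ 1) {s : ℂ} (hs : 0 < s.re) :
    Summable (nsmT χ s) := by
  refine Summable.of_norm_bounded ?_ (fun n => nsmT_le hχ n (θ := 1) zero_le_one le_rfl hs)
  exact (nsm_summable_shift (by linarith)).mul_left _

lemma nsm_LSeries_eq {q : ℕ} [NeZero q] {χ : DirichletCharacter ℂ q} (hχ : χ ≠ 1) {s : ℂ} (hs : 1 < s.re) :
    χ.LFunction s = ∑' n, nsmT χ s n := by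
  rw [χ.LFunction_eq_LSeries hs]
  have hsum := χ.LSeriesSummable_of_one_lt_re hs
  have h1 := hsum.LSeriesHasSum
  have h2 := (hasSum_nat_add_iff' 1).2 h1
  have h3 := h2.tendsto_sum_nat
  have h4 : ∀ N : ℕ, ∑ i ∈ Finset.range N, LSeries.term (fun n => χ n) s (i + 1) =
      nsmS χ N * ((N + 1 : ℕ) : ℂ) ^ (-s) + ∑ n ∈ Finset.range N, nsmT χ s n := by
    intro N
    rw [← nsm_abel]
    refine Finset.sum_congr rfl fun n _ => ?_
    rw [LSeries.term_of_ne_zero (by omega), Complex.cpow_neg, div_eq_mul_inv]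
  simp only [h4, Finset.sum_range_one, LSeries.term_zero, sub_zero] at h3
  have h5 := (nsm_summable_T hχ (s := s) (by linarith)).hasSum.tendsto_sum_nat
  have h6 : Filter.Tendsto (fun N : ℕ => nsmS χ N * ((N + 1 : ℕ) : ℂ) ^ (-s)) Filter.atTop (nhds 0) := by
    apply squeeze_zero_norm (a := fun N : ℕ => (q : ℝ) * ((N + 1 : ℕ) : ℝ) ^ (-s.re))
    · intro N
      rw [norm_mul]
      have : ‖((N + 1 : ℕ) : ℂ) ^ (-s)‖ = ((N + 1 : ℕ) : ℝ) ^ (-s.re) := by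
        have := Complex.norm_cpow_eq_rpow_re_of_pos (x := ((N + 1 : ℕ) : ℝ)) (by positivity) (-s)
        simpa using this
      rw [this]
      gcongr
      exact nsmS_le_q hχ N
    · have h7 := (tendsto_rpow_neg_atTop (y := s.re) (by linarith)).comp
        ((tendsto_natCast_atTop_atTop (R := ℝ)).comp (Filter.tendsto_add_atTop_nat 1))
      simpa using h7.const_mul (q : ℝ)
  have h8 := h6.add h5
  rw [zero_add] at h8
  exact tendsto_nhds_unique h3 h8

lemma nsm_diff_T {q : ℕ} [NeZero q] {χ : DirichletCharacter ℂ q} (hχ : χ ≠ 1) :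
    DifferentiableOn ℂ (fun s => ∑' n, nsmT χ s n) {s | 0 < s.re} := by
  intro s hs
  have hs' : 0 < s.re := hs
  set U : Set ℂ := {z | s.re / 2 < z.re} ∩ Metric.ball 0 (‖s‖ + 1) with hU
  have hUo : IsOpen U := (isOpen_lt continuous_const Complex.continuous_re).inter Metric.isOpen_ball
  have hsU : s ∈ U := ⟨by simp; linarith, by simp⟩
  have := Complex.differentiableOn_tsum_of_summable_norm
    (u := fun n : ℕ => (‖s‖ + 1) * (q : ℝ) ^ (1 : ℝ) * ((n + 1 : ℕ) : ℝ) ^ (-(s.re / 2 + 1)))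
    (F := fun n z => nsmT χ z n) (U := U) ((nsm_summable_shift (by linarith)).mul_left _) ?_ hUo ?_
  · exact ((this s hsU).differentiableAt (hUo.mem_nhds hsU)).differentiableWithinAt
  · intro n z _
    unfold nsmT
    refine DifferentiableAt.differentiableWithinAt ?_
    refine DifferentiableAt.const_mul ?_ _
    refine DifferentiableAt.sub ?_ ?_
    · exact DifferentiableAt.const_cpow differentiableAt_id.neg (Or.inl (Nat.cast_ne_zero.2 (by omega)))
    · exact DifferentiableAt.const_cpow differentiableAt_id.neg (Or.inl (Nat.cast_ne_zero.2 (by omega)))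
  · intro n z hz
    obtain ⟨hz1, hz2⟩ := hz
    have hz1' : s.re / 2 < z.re := hz1
    refine (nsmT_le hχ n (θ := 1) zero_le_one le_rfl (s := z) (by linarith)).trans ?_
    have : ‖z‖ ≤ ‖s‖ + 1 := by simp at hz2; linarith
    gcongr
    · norm_cast; omega

lemma nsm_LFunction_eq {q : ℕ} [NeZero q] {χ : DirichletCharacter ℂ q} (hχ : χ ≠ 1) {s : ℂ} (hs : 0 < s.re) :
    χ.LFunction s = ∑' n, nsmT χ s n := by
  have hUo : IsOpen {s : ℂ | 0 < s.re} := isOpen_lt continuous_const Complex.continuous_re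
  have h1 : AnalyticOnNhd ℂ χ.LFunction {s : ℂ | 0 < s.re} :=
    (differentiable_LFunction hχ).differentiableOn.analyticOnNhd hUo
  have h2 := (nsm_diff_T hχ).analyticOnNhd hUo
  refine h1.eqOn_of_preconnected_of_eventuallyEq h2 (convex_halfSpace_re_gt 0).isPreconnected
    (z₀ := 2) (by simp) ?_ hs
  have : {s : ℂ | 1 < s.re} ∈ nhds (2 : ℂ) :=
    (isOpen_lt continuous_const Complex.continuous_re).mem_nhds (by simp)
  filter_upwards [this] with z hz
  exact nsm_LSeries_eq hχ hz

/-- The zeta-like constant -/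
noncomputable def nsmZ (a : ℝ) : ℝ := ∑' n : ℕ, ((n + 1 : ℕ) : ℝ) ^ (-a)

lemma nsmZ_anti {a b : ℝ} (ha : 1 < a) (hab : a ≤ b) : nsmZ b ≤ nsmZ a := by
  unfold nsmZ
  refine Summable.tsum_le_tsum (fun n => ?_) (nsm_summable_shift (by linarith)) (nsm_summable_shift ha)
  gcongr
  norm_cast; omega

lemma nsmZ_one_le {a : ℝ} (ha : 1 < a) : 1 ≤ nsmZ a := by
  unfold nsmZ
  have := (nsm_summable_shift ha).le_tsum 0 (fun j _ => by positivity)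
  simpa using this

lemma nsm_L_bound {q : ℕ} [NeZero q] {χ : DirichletCharacter ℂ q} (hχ : χ ≠ 1) {θ : ℝ}
    (h0 : 0 ≤ θ) (h1 : θ ≤ 1) {s : ℂ} (hs : 0 < s.re) (hs1 : 1 < s.re + θ) :
    ‖χ.LFunction s‖ ≤ ‖s‖ * (q : ℝ) ^ θ * nsmZ (s.re + θ) := by
  rw [nsm_LFunction_eq hχ hs]
  refine tsum_of_norm_bounded ?_ (fun n => nsmT_le hχ n h0 h1 hs)
  exact (nsm_summable_shift hs1).hasSum.mul_left _

/-- real on the real axis for quadratic characters -/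
lemma nsm_L_conj {q : ℕ} [NeZero q] {χ : DirichletCharacter ℂ q} (hχ : χ ≠ 1)
    (hr : ∀ a, (starRingEnd ℂ) (χ a) = χ a) {x : ℝ} (hx : 0 < x) :
    (χ.LFunction x).im = 0 := by
  rw [nsm_LFunction_eq hχ (by simpa using hx)]
  have : ∀ n, (nsmT χ x n).im = 0 := by
    intro n
    rw [← Complex.conj_eq_iff_im]
    unfold nsmT nsmS
    have e : ∀ m : ℕ, (starRingEnd ℂ) ((m : ℂ) ^ (-(x : ℂ))) = (m : ℂ) ^ (-(x : ℂ)) := by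
      intro m
      have : (m : ℂ) ^ (-(x : ℂ)) = (((m : ℝ) ^ (-x) : ℝ) : ℂ) := by
        rw [Complex.ofReal_cpow (by positivity)]; simp
      rw [this, Complex.conj_ofReal]
    rw [map_mul, map_sub, e, e, map_sum]
    simp only [hr]
  rw [Complex.im_tsum (nsm_summable_T hχ (by simpa using hx))]
  simp [this]

lemma nsm_telescope (n : ℕ) {x : ℝ} (hx : 0 < x) :
    ((n + 2 : ℕ) : ℝ) ^ (-(1 + x)) ≤ (1 / x) * (((n + 1 : ℕ) : ℝ) ^ (-x) - ((n + 2 : ℕ) : ℝ) ^ (-x)) := by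
  have h1 : (0 : ℝ) < ((n + 1 : ℕ) : ℝ) := by positivity
  have h2 : (0 : ℝ) < ((n + 2 : ℕ) : ℝ) := by positivity
  have e1 : ((n + 2 : ℕ) : ℝ) ^ (-(1 + x)) = ((n + 2 : ℕ) : ℝ) ^ (-x) * (1 / ((n + 2 : ℕ) : ℝ)) := by
    rw [show -(1 + x) = -x + -1 by ring, Real.rpow_add h2, Real.rpow_neg_one, one_div]
  have e2 : ((n + 1 : ℕ) : ℝ) ^ (-x) = ((n + 2 : ℕ) : ℝ) ^ (-x) *
      (((n + 1 : ℕ) : ℝ) / ((n + 2 : ℕ) : ℝ)) ^ (-x) := by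
    rw [← Real.mul_rpow h2.le (by positivity)]
    congr 1
    field_simp
  have h3 : 1 + x / ((n + 2 : ℕ) : ℝ) ≤ (((n + 1 : ℕ) : ℝ) / ((n + 2 : ℕ) : ℝ)) ^ (-x) := by
    rw [Real.rpow_def_of_pos (by positivity)]
    refine le_trans ?_ (Real.add_one_le_exp _)
    have := Real.log_le_sub_one_of_pos (x := ((n + 1 : ℕ) : ℝ) / ((n + 2 : ℕ) : ℝ)) (by positivity)
    have e3 : ((n + 1 : ℕ) : ℝ) / ((n + 2 : ℕ) : ℝ) - 1 = - (1 / ((n + 2 : ℕ) : ℝ)) := by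
      field_simp; push_cast; ring
    rw [e3] at this
    have : x * (1 / ((n + 2 : ℕ) : ℝ)) ≤ x * (- Real.log (((n + 1 : ℕ) : ℝ) / ((n + 2 : ℕ) : ℝ))) := by
      gcongr; linarith
    have e4 : x * (1 / ((n + 2 : ℕ) : ℝ)) = x / ((n + 2 : ℕ) : ℝ) := by ring
    nlinarith
  rw [e1, e2]
  have h4 : (0 : ℝ) < ((n + 2 : ℕ) : ℝ) ^ (-x) := by positivity
  have h5 : 1 / ((n + 2 : ℕ) : ℝ) ≤ 1 / x * ((((n + 1 : ℕ) : ℝ) / ((n + 2 : ℕ) : ℝ)) ^ (-x) - 1) := by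
    have : 1 / ((n + 2 : ℕ) : ℝ) = 1 / x * (x / ((n + 2 : ℕ) : ℝ)) := by field_simp
    rw [this]
    gcongr
    linarith
  calc _ ≤ ((n + 2 : ℕ) : ℝ) ^ (-x) * (1 / x * ((((n + 1 : ℕ) : ℝ) / ((n + 2 : ℕ) : ℝ)) ^ (-x) - 1)) := by gcongr
    _ = _ := by ring

lemma nsmZ_le {x : ℝ} (hx : 0 < x) : nsmZ (1 + x) ≤ 1 + 1 / x := by
  unfold nsmZ
  have key : ∀ N : ℕ, ∑ n ∈ Finset.range (N + 1), ((n + 1 : ℕ) : ℝ) ^ (-(1 + x)) ≤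
      1 + 1 / x * (1 - ((N + 1 : ℕ) : ℝ) ^ (-x)) := by
    intro N
    induction N with
    | zero => simp
    | succ N ih =>
      rw [Finset.sum_range_succ]
      have := nsm_telescope N hx
      linarith
  refine Real.tsum_le_of_sum_range_le (fun n => by positivity) (fun N => ?_)
  rcases N with _ | N
  · simp; positivity
  · refine (key N).trans ?_
    have : (0 : ℝ) ≤ ((N + 1 : ℕ) : ℝ) ^ (-x) := by positivity
    have : 1 / x * (1 - ((N + 1 : ℕ) : ℝ) ^ (-x)) ≤ 1 / x * 1 := by gcongr; linarith
    linarith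

lemma nsm_L_bounds (θ : ℝ) (h0 : 0 < θ) (h1 : θ ≤ 1) : ∃ C : ℝ, 1 ≤ C ∧ ∀ (q : ℕ) [NeZero q]
    (χ : DirichletCharacter ℂ q), χ ≠ 1 → ∀ x : ℝ, 0 ≤ x → x ≤ 1 →
      ‖χ.LFunction (1 + x)‖ ≤ C * (q : ℝ) ^ θ ∧
      ‖χ.LFunction (1 + x) - χ.LFunction 1‖ ≤ C * (q : ℝ) ^ θ * x := by
  refine ⟨3 * nsmZ (1 + θ / 2) / (θ / 2), ?_, ?_⟩
  · have := nsmZ_one_le (a := 1 + θ / 2) (by linarith)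
    rw [le_div_iff₀ (by positivity)]; linarith
  intro q _ χ hχ
  have hq : (0 : ℝ) < (q : ℝ) ^ θ := by
    have : 0 < q := Nat.pos_of_ne_zero (NeZero.ne q)
    positivity
  have hZ := nsmZ_one_le (a := 1 + θ / 2) (by linarith)
  have B : ∀ s : ℂ, 1 - θ / 2 ≤ s.re → ‖s‖ ≤ 3 → ‖χ.LFunction s‖ ≤ 3 * nsmZ (1 + θ / 2) * (q : ℝ) ^ θ := by
    intro s hs hs3
    refine (nsm_L_bound hχ h0.le h1 (s := s) (by linarith) (by linarith)).trans ?_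
    have := nsmZ_anti (a := 1 + θ / 2) (b := s.re + θ) (by linarith) (by linarith)
    calc ‖s‖ * (q : ℝ) ^ θ * nsmZ (s.re + θ) ≤ 3 * (q : ℝ) ^ θ * nsmZ (1 + θ / 2) := by
          have := nsmZ_one_le (a := s.re + θ) (by linarith)
          gcongr
      _ = _ := by ring
  have D : ∀ x : ℝ, 0 ≤ x → x ≤ 1 → ‖deriv χ.LFunction (1 + x)‖ ≤ 3 * nsmZ (1 + θ / 2) * (q : ℝ) ^ θ / (θ / 2) := by
    intro x hx0 hx1
    refine Complex.norm_deriv_le_of_forall_mem_sphere_norm_le (by positivity)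
      (differentiable_LFunction hχ).diffContOnCl ?_
    intro z hz
    have hz' : ‖z - (1 + x)‖ = θ / 2 := by simpa [dist_eq_norm] using hz
    apply B
    · have := (abs_le.1 ((Complex.abs_re_le_norm _).trans hz'.le)).1
      simp at this; linarith
    · have e : z = (z - (1 + x)) + ((1 + x : ℝ) : ℂ) := by push_cast; ring
      rw [e]
      refine (norm_add_le _ _).trans ?_
      rw [hz', Complex.norm_real, Real.norm_of_nonneg (by linarith)]
      linarith
  intro x hx0 hx1
  constructor
  · refine (B (1 + x) (by simp; linarith) ?_).trans ?_
    · rw [show (1 + x : ℂ) = ((1 + x : ℝ) : ℂ) by push_cast; ring, Complex.norm_real, Real.norm_of_nonneg (by linarith)]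
      linarith
    · gcongr
      rw [le_div_iff₀ (by positivity)]
      nlinarith
  · have hd : ∀ y ∈ Set.Icc (0 : ℝ) 1, HasDerivWithinAt (fun y : ℝ => χ.LFunction (1 + y))
        (deriv χ.LFunction (1 + y)) (Set.Icc (0 : ℝ) 1) y := by
      intro y _
      have h2 : HasDerivAt (fun y : ℂ => χ.LFunction (1 + y)) (deriv χ.LFunction (1 + y)) (y : ℂ) := by
        have h3 := (differentiable_LFunction hχ (1 + y)).hasDerivAt
        exact HasDerivAt.comp_const_add (1 : ℂ) (y : ℂ) h3
      exact h2.comp_ofReal.hasDerivWithinAt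
    have := Convex.norm_image_sub_le_of_norm_hasDerivWithin_le (𝕜 := ℝ) hd (fun y hy => D y hy.1 hy.2)
      (convex_Icc _ _) (x := 0) (y := x) (by simp) ⟨hx0, hx1⟩
    simp only [ofReal_zero, add_zero, sub_zero] at this
    refine this.trans ?_
    rw [Real.norm_of_nonneg hx0]
    apply le_of_eq; ring

lemma nsm_triv_bound (q : ℕ) [NeZero q] {x : ℝ} (hx : 0 < x) (hx1 : x ≤ 1) :
    ‖LFunctionTrivChar q (1 + x)‖ ≤ 2 / x := by
  unfold LFunctionTrivChar
  rw [LFunction_eq_LSeries _ (by simpa using hx)]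
  have hs := LSeriesSummable_of_one_lt_re (1 : DirichletCharacter ℂ q) (s := 1 + x) (by simpa using hx)
  have h2 := (hasSum_nat_add_iff' 1).2 hs.LSeriesHasSum
  simp only [Finset.sum_range_one, LSeries.term_zero, sub_zero] at h2
  rw [← h2.tsum_eq]
  have h3 : nsmZ (1 + x) ≤ 2 / x := by
    refine (nsmZ_le hx).trans ?_
    rw [le_div_iff₀ hx, add_mul]; field_simp; linarith
  refine le_trans ?_ h3
  refine tsum_of_norm_bounded (nsm_summable_shift (a := 1 + x) (by linarith)).hasSum ?_
  intro n
  rw [LSeries.term_of_ne_zero (by omega), norm_div]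
  have : ‖((n + 1 : ℕ) : ℂ) ^ (1 + x : ℂ)‖ = ((n + 1 : ℕ) : ℝ) ^ (1 + x) := by
    have := Complex.norm_cpow_eq_rpow_re_of_pos (x := ((n + 1 : ℕ) : ℝ)) (by positivity) (1 + x)
    simpa using this
  rw [this, Real.rpow_neg (by positivity), ← one_div]
  gcongr
  exact DirichletCharacter.norm_le_one _ _

/-- Lower bound for non-quadratic characters. -/
lemma nsm_complex : ∃ c : ℝ, 0 < c ∧ ∀ (q : ℕ) [NeZero q]
    (χ : DirichletCharacter ℂ q), χ ^ 2 ≠ 1 → c * (q : ℝ) ^ (-(1/4) : ℝ) ≤ ‖χ.LFunction 1‖ := by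
  obtain ⟨C, hC1, hC⟩ := nsm_L_bounds (1/16) (by norm_num) (by norm_num)
  -- choose x = k^4 * q^(-5/16), with c0 k^3 = 2 C k^4, c0^4 = 1/(8 C)
  set k : ℝ := 1 / (8 * C) / (2 * C) with hk
  have hk0 : 0 < k := by positivity
  refine ⟨C * k ^ 4, by positivity, ?_⟩
  intro q _ χ hχ2
  have hχ : χ ≠ 1 := by rintro rfl; simp at hχ2
  have hq1 : (1 : ℝ) ≤ q := by exact_mod_cast Nat.pos_of_ne_zero (NeZero.ne q)
  have hq0 : (0 : ℝ) < q := by linarith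
  set y : ℝ := (q : ℝ) ^ (-(1/16) : ℝ) with hy
  have hy0 : 0 < y := by positivity
  have hy1 : y ≤ 1 := Real.rpow_le_one_of_one_le_of_nonpos hq1 (by norm_num)
  have hyi : (q : ℝ) ^ (1/16 : ℝ) = 1 / y := by
    rw [hy, Real.rpow_neg hq0.le]; simp
  have hy4 : (q : ℝ) ^ (-(1/4) : ℝ) = y ^ 4 := by
    rw [hy, ← Real.rpow_natCast, ← Real.rpow_mul hq0.le]; norm_num
  have hk1 : k ≤ 1 := by
    rw [hk, div_div, div_le_one (by positivity)]; nlinarith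
  set x : ℝ := k ^ 4 * y ^ 5 with hx
  have hx0 : 0 < x := by positivity
  have hx1 : x ≤ 1 := mul_le_one₀ (pow_le_one₀ hk0.le hk1) (by positivity) (pow_le_one₀ hy0.le hy1)
  have h341 := norm_LFunction_product_ge_one χ hx0 0
  simp only [ofReal_zero, mul_zero, add_zero, norm_mul, norm_pow] at h341
  have hT := nsm_triv_bound q hx0 hx1
  obtain ⟨-, hd⟩ := hC q χ hχ x hx0.le hx1
  obtain ⟨hb, -⟩ := hC q _ hχ2 x hx0.le hx1
  rw [hyi] at hd hb
  set ℓ := ‖χ.LFunction (1 + x)‖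
  have hl0 : 0 ≤ ℓ := norm_nonneg _
  have h5 : 1 ≤ (2 / x) ^ 3 * ℓ ^ 4 * (C * (1 / y)) := by
    refine h341.le.trans ?_
    gcongr
  have h6 : x ^ 3 * y ≤ 8 * C * ℓ ^ 4 := by
    have e : (2 / x) ^ 3 * ℓ ^ 4 * (C * (1 / y)) = (8 * C * ℓ ^ 4) / (x ^ 3 * y) := by
      field_simp; ring
    rw [e, le_div_iff₀ (by positivity)] at h5
    linarith
  have h7 : (2 * C * k ^ 4 * y ^ 4) ^ 4 ≤ ℓ ^ 4 := by
    have : (2 * C * k ^ 4 * y ^ 4) ^ 4 * (8 * C) ≤ x ^ 3 * y := by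
      have hkk : k * (16 * C ^ 2) = 1 := by rw [hk]; field_simp; norm_num
      have e : (2 * C * k ^ 4 * y ^ 4) ^ 4 * (8 * C) = (x ^ 3 * y) * (k * (16 * C ^ 2)) * (k ^ 3 * (8 * C ^ 3)) := by
        rw [hx]; ring
      rw [e, hkk, mul_one]
      have : k ^ 3 * (8 * C ^ 3) ≤ 1 := by
        have : k * (2 * C) ≤ 1 := by
          have : k * (2 * C) ≤ k * (16 * C ^ 2) := by
            gcongr ?_ * ?_; nlinarith
          linarith
        calc k ^ 3 * (8 * C ^ 3) = (k * (2 * C)) ^ 3 := by ring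
          _ ≤ 1 := pow_le_one₀ (by positivity) this
      exact mul_le_of_le_one_right (by positivity) this
    have h8 : (2 * C * k ^ 4 * y ^ 4) ^ 4 * (8 * C) ≤ ℓ ^ 4 * (8 * C) := by linarith
    exact le_of_mul_le_mul_right h8 (by positivity)
  have h8 : 2 * C * k ^ 4 * y ^ 4 ≤ ℓ := le_of_pow_le_pow_left₀ (by norm_num) hl0 h7
  have h9 : C * (1 / y) * x = C * k ^ 4 * y ^ 4 := by rw [hx]; field_simp
  rw [h9] at hd
  rw [hy4]
  have := norm_sub_norm_le (χ.LFunction (1 + x)) (χ.LFunction 1)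
  linarith

open scoped ComplexOrder in
lemma nsm_estermann : ∃ A : ℝ, 1 ≤ A ∧ ∀ (G : ℂ → ℂ) (a : ℕ → ℂ) (lam K t : ℝ),
    Differentiable ℂ G → 0 ≤ a → a 1 = 1 → LSeries.abscissaOfAbsConv a ≤ 1 →
    (∀ s : ℂ, 1 < s.re → LSeries a s = riemannZeta s * G s) →
    G 1 = lam → (∀ s ∈ Metric.closedBall (2 : ℂ) (4/3), ‖G s‖ ≤ K) →
    1 < t → t ≤ 9/8 → (riemannZeta ((2 - t : ℝ) : ℂ) * G ((2 - t : ℝ) : ℂ)).re ≤ 0 →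
    ∀ M : ℕ, 1 ≤ M → 1 ≤ lam * t ^ M / (t - 1) + 32 / 5 * (A * K) * (27 / 32) ^ M := by
  have hcont : ContinuousOn riemannZeta (Metric.sphere (2 : ℂ) (4/3)) := by
    intro z hz
    refine (differentiableAt_riemannZeta ?_).continuousAt.continuousWithinAt
    rintro rfl
    simp at hz
    norm_num at hz
  obtain ⟨B, hB⟩ := (isCompact_sphere (2 : ℂ) (4/3)).exists_bound_of_continuousOn hcont
  refine ⟨max B 0 + 3, by linarith [le_max_right B 0], ?_⟩
  intro G a lam K t hG ha ha1 habs hL hlam hK ht1 ht2 hneg M hM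
  have hK0 : 0 ≤ K := (norm_nonneg _).trans (hK 2 (by simp; norm_num))
  set A := max B 0 + 3 with hA
  set h := LFunctionTrivChar₁ 1 with hh
  have hhd : Differentiable ℂ h := differentiable_LFunctionTrivChar₁ 1
  have hh1 : h 1 = 1 := by simp [hh, LFunctionTrivChar₁]
  have hhne : ∀ s : ℂ, s ≠ 1 → h s = (s - 1) * riemannZeta s := by
    intro s hs
    simp only [hh, LFunctionTrivChar₁]
    rw [Function.update_of_ne hs, LFunctionTrivChar, LFunction_modOne_eq]
  set H : ℂ → ℂ := fun s => h s * G s with hH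
  have hHd : Differentiable ℂ H := hhd.mul hG
  have hH1 : H 1 = lam := by simp [hH, hh1, hlam]
  set g := dslope H 1 with hg
  have hgd : Differentiable ℂ g := by
    rw [← differentiableOn_univ]
    exact (Complex.differentiableOn_dslope Filter.univ_mem).2 hHd.differentiableOn
  have hgne : ∀ s : ℂ, s ≠ 1 → g s = riemannZeta s * G s - lam * (s - 1)⁻¹ := by
    intro s hs
    rw [hg, dslope_of_ne _ hs, slope_def_field, hH1]
    simp only [hH, hhne s hs]
    have : s - 1 ≠ 0 := sub_ne_zero.2 hs
    field_simp
  have hgb : ∀ z ∈ Metric.sphere (2 : ℂ) (4/3), ‖g z‖ ≤ A * K := by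
    intro z hz
    have hz' : ‖z - 2‖ = 4/3 := by simpa [dist_eq_norm] using hz
    have h3 : 1/3 ≤ ‖z - 1‖ := by
      have : ‖z - 2‖ ≤ ‖z - 1‖ + ‖(-1 : ℂ)‖ := by
        refine le_trans (le_of_eq ?_) (norm_add_le _ _); congr 1; ring
      simp at this; linarith
    have hz1 : z ≠ 1 := by rintro rfl; simp at h3; norm_num at h3
    rw [hgne z hz1]
    have h4 : ‖(lam : ℂ)‖ ≤ K := by
      rw [← hlam]; exact hK 1 (by simp [dist_eq_norm]; norm_num)
    have h5 : ‖(z - 1)⁻¹‖ ≤ 3 := by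
      rw [norm_inv]
      exact inv_le_of_inv_le₀ (by norm_num) (by linarith)
    calc _ ≤ ‖riemannZeta z * G z‖ + ‖lam * (z - 1)⁻¹‖ := norm_sub_le _ _
      _ ≤ max B 0 * K + K * 3 := by
        rw [norm_mul, norm_mul]
        gcongr
        · exact (hB z hz).trans (le_max_left _ _)
        · exact hK z (Metric.sphere_subset_closedBall hz)
      _ = A * K := by rw [hA]; ring
  have hcau : ∀ m : ℕ, ‖iteratedDeriv m g 2‖ ≤ m.factorial * (A * K) / (4/3) ^ m := fun m =>
    Complex.norm_iteratedDeriv_le_of_forall_mem_sphere_norm_le m (by norm_num) hgd.diffContOnCl hgb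
  have habs2 : LSeries.abscissaOfAbsConv a < (2 : ℝ) := lt_of_le_of_lt habs (by norm_cast)
  set d : ℕ → ℝ := fun m => ((-1) ^ m * iteratedDeriv m g 2).re / m.factorial with hd
  have hder : ∀ m : ℕ, iteratedDeriv m g 2 = iteratedDeriv m (LSeries a) 2 - lam * ((-1) ^ m * m.factorial) := by
    intro m
    have ev : g =ᶠ[nhds 2] ((LSeries a) - fun s : ℂ => (lam : ℂ) * (s - 1)⁻¹) := by
      have : {s : ℂ | 1 < s.re} ∈ nhds (2 : ℂ) :=
        (isOpen_lt continuous_const Complex.continuous_re).mem_nhds (by simp)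
      filter_upwards [this] with s hs
      have hs' : 1 < s.re := hs
      have : s ≠ 1 := by rintro rfl; simp at hs'
      simp only [Pi.sub_apply]
      rw [hgne s this, hL s hs']
    rw [ev.iteratedDeriv_eq, iteratedDeriv_sub, iteratedDeriv_const_mul_field]
    · congr 2
      have := iteratedDeriv_comp_sub_const (𝕜 := ℂ) m (fun z : ℂ => z⁻¹) 1
      rw [this, iteratedDeriv_eq_iterate]
      have h2 := iter_deriv_inv (𝕜 := ℂ) m (2 - 1)
      change deriv^[m] Inv.inv (2 - 1 : ℂ) = _
      rw [show (2 - 1 : ℂ) = 1 by norm_num] at h2 ⊢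
      simpa using h2
    · have : AnalyticAt ℂ (LSeries a) 2 := by
        apply LSeries_analyticOnNhd a
        simpa using habs2
      exact this.contDiffAt
    · refine ContDiffAt.mul contDiffAt_const ?_
      refine ContDiffAt.inv (by fun_prop) (by norm_num)
  have hpos : ∀ m : ℕ, 0 ≤ ((-1) ^ m * iteratedDeriv m (LSeries a) 2).re := by
    intro m
    have := LSeries.iteratedDeriv_alternating ha habs2 m
    have := (Complex.le_def.1 this).1
    simpa using this
  have hdval : ∀ m, d m = ((-1) ^ m * iteratedDeriv m (LSeries a) 2).re / m.factorial - lam := by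
    intro m
    have hf : (m.factorial : ℝ) ≠ 0 := by positivity
    rw [hd]; simp only
    rw [hder m, eq_sub_iff_add_eq, div_add' _ _ _ hf]
    congr 1
    have e : (-1 : ℂ) ^ m * (iteratedDeriv m (LSeries a) 2 - lam * ((-1) ^ m * m.factorial)) =
      (-1 : ℂ) ^ m * iteratedDeriv m (LSeries a) 2 - ((lam * m.factorial : ℝ) : ℂ) := by
      have : (-1 : ℂ) ^ m * (-1 : ℂ) ^ m = 1 := by rw [← mul_pow]; simp
      push_cast
      linear_combination (-(lam : ℂ) * m.factorial) * this
    rw [e, Complex.sub_re, Complex.ofReal_re]; ring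
  have hdlow : ∀ m, -lam ≤ d m := by
    intro m
    rw [hdval m]
    have := div_nonneg (hpos m) (Nat.cast_nonneg (α := ℝ) m.factorial)
    linarith
  have hd0 : 1 - lam ≤ d 0 := by
    rw [hdval 0]
    simp only [pow_zero, one_mul, iteratedDeriv_zero, Nat.factorial_zero, Nat.cast_one, div_one]
    have hsum : LSeriesSummable a 2 := LSeriesSummable_of_abscissaOfAbsConv_lt_re (by simpa using habs2)
    have : 1 ≤ (LSeries a 2).re := by
      unfold LSeries
      rw [Complex.re_tsum hsum]
      have hr : Summable fun n => (LSeries.term a 2 n).re := (Complex.hasSum_re hsum.hasSum).summable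
      have := hr.le_tsum 1 (fun j _ => ?_)
      · refine le_trans (le_of_eq ?_) this
        rw [LSeries.term_of_ne_zero one_ne_zero]; simp [ha1]
      · rcases eq_or_ne j 0 with rfl | hj
        · simp
        · rw [LSeries.term_of_ne_zero hj]
          have h1 : (j : ℂ) ^ (2 : ℂ) = (((j : ℝ) ^ 2 : ℝ) : ℂ) := by push_cast; norm_cast
          rw [h1, Complex.div_ofReal_re]
          have := (Complex.le_def.1 (ha j)).1
          simp at this
          positivity
    linarith
  have hdabs : ∀ m, |d m| ≤ A * K * (3/4) ^ m := by
    intro m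
    have hf : (0 : ℝ) < (m.factorial : ℝ) := by positivity
    rw [hd]; simp only
    rw [abs_div, abs_of_pos hf, div_le_iff₀ hf]
    refine (Complex.abs_re_le_norm _).trans ?_
    rw [norm_mul, norm_pow, norm_neg, norm_one, one_pow, one_mul]
    refine (hcau m).trans (le_of_eq ?_)
    rw [show (3/4 : ℝ) = (4/3)⁻¹ by norm_num, inv_pow]
    ring
  have htay := Complex.hasSum_taylorSeries_of_entire hgd 2 ((2 - t : ℝ) : ℂ)
  have htay2 : HasSum (fun m => t ^ m * d m) (g ((2 - t : ℝ) : ℂ)).re := by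
    convert Complex.hasSum_re htay using 1
    funext m
    have e : (((m.factorial : ℂ))⁻¹ • (((2 - t : ℝ) : ℂ) - 2) ^ m • iteratedDeriv m g 2) =
        ((t ^ m / m.factorial : ℝ) : ℂ) * ((-1) ^ m * iteratedDeriv m g 2) := by
      rw [show (((2 - t : ℝ) : ℂ) - 2) = (-1) * (t : ℂ) by push_cast; ring, mul_pow]
      simp only [smul_eq_mul]
      push_cast
      ring
    rw [e, Complex.re_ofReal_mul, hd]
    ring
  have hsplit := htay2.summable.sum_add_tsum_nat_add M
  rw [htay2.tsum_eq] at hsplit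
  have ht0 : 0 < t - 1 := by linarith
  have hfin : 1 - lam * ((t ^ M - 1) / (t - 1)) ≤ ∑ m ∈ Finset.range M, t ^ m * d m := by
    obtain ⟨M', rfl⟩ : ∃ M', M = M' + 1 := ⟨M - 1, by omega⟩
    rw [← geom_sum_eq (by linarith : t ≠ 1), Finset.sum_range_succ', Finset.sum_range_succ' _ M', mul_add,
      Finset.mul_sum]
    have : ∑ m ∈ Finset.range M', -(lam * t ^ (m + 1)) ≤ ∑ m ∈ Finset.range M', t ^ (m + 1) * d (m + 1) := by
      refine Finset.sum_le_sum fun m _ => ?_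
      have := mul_le_mul_of_nonneg_left (hdlow (m + 1)) (by positivity : 0 ≤ t ^ (m + 1))
      linarith
    rw [Finset.sum_neg_distrib] at this
    simp only [pow_zero, one_mul, mul_one]
    linarith
  have htail : -(32 / 5 * (A * K) * (27 / 32) ^ M) ≤ ∑' m, t ^ (m + M) * d (m + M) := by
    have hg : HasSum (fun m : ℕ => A * K * (27/32 : ℝ) ^ M * (27/32 : ℝ) ^ m) (A * K * (27/32 : ℝ) ^ M * (32/5)) := by
      refine HasSum.mul_left _ ?_
      have := hasSum_geometric_of_lt_one (r := (27/32 : ℝ)) (by norm_num) (by norm_num)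
      rwa [show (1 - 27/32 : ℝ)⁻¹ = 32/5 by norm_num] at this
    have := tsum_of_norm_bounded hg (f := fun m => t ^ (m + M) * d (m + M)) (fun m => by
      rw [norm_mul, Real.norm_eq_abs, Real.norm_eq_abs, abs_of_nonneg (by positivity : 0 ≤ t ^ (m + M))]
      calc t ^ (m + M) * |d (m + M)| ≤ (9/8) ^ (m + M) * (A * K * (3/4) ^ (m + M)) := by
            gcongr
            exact hdabs _
        _ = A * K * ((9/8) * (3/4)) ^ (m + M) := by rw [mul_pow]; ring
        _ = _ := by rw [show (9/8 * (3/4) : ℝ) = 27/32 by norm_num, pow_add]; ring)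
    rw [Real.norm_eq_abs] at this
    have := (abs_le.1 this).1
    linarith
  have hz1 : ((2 - t : ℝ) : ℂ) ≠ 1 := by
    intro h
    have := congrArg Complex.re h
    simp at this; linarith
  have hgr : (g ((2 - t : ℝ) : ℂ)).re ≤ lam / (t - 1) := by
    rw [hgne _ hz1, Complex.sub_re]
    have e : (lam : ℂ) * (((2 - t : ℝ) : ℂ) - 1)⁻¹ = ((lam * (2 - t - 1)⁻¹ : ℝ) : ℂ) := by push_cast; ring
    rw [e, Complex.ofReal_re]
    have e2 : lam / (t - 1) = - (lam * (2 - t - 1)⁻¹) := by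
      rw [show 2 - t - 1 = -(t - 1) by ring, inv_neg]; ring
    rw [e2]; linarith
  have e3 : lam * ((t ^ M - 1) / (t - 1)) = lam * t ^ M / (t - 1) - lam / (t - 1) := by ring
  rw [e3] at hfin
  linarith

/-- the arithmetic function of a character -/
noncomputable def nsmA {N : ℕ} (χ : DirichletCharacter ℂ N) : ArithmeticFunction ℂ :=
  toArithmeticFunction (χ ·)

lemma nsmA_apply {N : ℕ} (χ : DirichletCharacter ℂ N) {n : ℕ} (hn : n ≠ 0) : nsmA χ n = χ n := by
  simp [nsmA, toArithmeticFunction, hn]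

lemma nsmA_mult {N : ℕ} (χ : DirichletCharacter ℂ N) : (nsmA χ).IsMultiplicative :=
  isMultiplicative_toArithmeticFunction χ

lemma nsm_zetaMul_eq {N : ℕ} (χ : DirichletCharacter ℂ N) :
    zetaMul χ = (ArithmeticFunction.zeta : ArithmeticFunction ℂ) * nsmA χ := rfl

lemma nsm_pmul {N : ℕ} (α β : DirichletCharacter ℂ N) {n : ℕ} (hn : n ≠ 0) :
    (nsmA β * nsmA (α * β)) n = β n * zetaMul α n := by
  rw [nsm_zetaMul_eq, ArithmeticFunction.mul_apply, ArithmeticFunction.mul_apply, Finset.mul_sum]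
  refine Finset.sum_congr rfl fun x hx => ?_
  obtain ⟨h1, h2⟩ := Nat.mem_divisorsAntidiagonal.1 hx
  have hx1 : x.1 ≠ 0 := by rintro h; simp [h] at h1; exact hn h1.symm
  have hx2 : x.2 ≠ 0 := by rintro h; simp [h] at h1; exact hn h1.symm
  rw [nsmA_apply _ hx1, nsmA_apply _ hx2, nsmA_apply _ hx2, ← h1]
  simp [hx1]
  ring

open scoped ComplexOrder in
lemma nsm_f_prime_pow_nonneg {N : ℕ} {α β : DirichletCharacter ℂ N} (hα : α ^ 2 = 1)
    {p : ℕ} (hp : p.Prime) (k : ℕ)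
    (h : ∀ j, 0 ≤ β ((p ^ j : ℕ)) * zetaMul α (p ^ j)) :
    0 ≤ (zetaMul α * (nsmA β * nsmA (α * β))) (p ^ k) := by
  rw [ArithmeticFunction.mul_apply]
  refine Finset.sum_nonneg fun x hx => ?_
  obtain ⟨h1, h2⟩ := Nat.mem_divisorsAntidiagonal.1 hx
  refine mul_nonneg (zetaMul_nonneg hα _) ?_
  obtain ⟨j, _, hj⟩ := (Nat.dvd_prime_pow hp).1 (Dvd.intro_left _ h1)
  rw [nsm_pmul _ _ (by rw [hj]; exact pow_ne_zero _ hp.ne_zero), hj]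
  exact h j

lemma nsm_f_symm {N : ℕ} (α β : DirichletCharacter ℂ N) :
    zetaMul α * (nsmA β * nsmA (α * β)) = zetaMul β * (nsmA α * nsmA (β * α)) := by
  rw [nsm_zetaMul_eq, nsm_zetaMul_eq, mul_comm β α]
  ring

open scoped ComplexOrder in
lemma nsm_f_nonneg {N : ℕ} {α β : DirichletCharacter ℂ N} (hα : α ^ 2 = 1) (hβ : β ^ 2 = 1)
    (n : ℕ) : 0 ≤ (zetaMul α * (nsmA β * nsmA (α * β))) n := by
  rcases eq_or_ne n 0 with rfl | hn
  · simp
  have hm : (zetaMul α * (nsmA β * nsmA (α * β))).IsMultiplicative :=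
    (isMultiplicative_zetaMul α).mul ((nsmA_mult β).mul (nsmA_mult _))
  rw [hm.multiplicative_factorization _ hn]
  refine Finset.prod_nonneg fun p hp => ?_
  have hp' := Nat.prime_of_mem_primeFactors hp
  rcases MulChar.isQuadratic_iff_sq_eq_one.mpr hβ p with h | h | h
  · refine nsm_f_prime_pow_nonneg hα hp' _ fun j => mul_nonneg ?_ (zetaMul_nonneg hα _)
    push_cast; rw [map_pow, h]; exact pow_nonneg le_rfl _
  · refine nsm_f_prime_pow_nonneg hα hp' _ fun j => mul_nonneg ?_ (zetaMul_nonneg hα _)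
    push_cast; rw [map_pow, h]; simp
  · rw [nsm_f_symm]
    refine nsm_f_prime_pow_nonneg hβ hp' _ fun j => ?_
    rcases Nat.even_or_odd j with hj | hj
    · refine mul_nonneg ?_ (zetaMul_nonneg hβ _)
      push_cast; rw [map_pow]
      rcases MulChar.isQuadratic_iff_sq_eq_one.mpr hα p with h' | h' | h'
      · rw [h']; exact pow_nonneg le_rfl _
      · rw [h']; simp
      · rw [h', hj.neg_one_pow]; simp
    · have : zetaMul β (p ^ j) = 0 := by
        rw [nsm_zetaMul_eq, ArithmeticFunction.coe_zeta_mul_apply, Nat.sum_divisors_prime_pow hp']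
        have : ∀ i ∈ Finset.range (j+1), nsmA β (p ^ i) = (-1)^i := by
          intro i _
          rw [nsmA_apply _ (pow_ne_zero _ hp'.ne_zero)]; push_cast; rw [map_pow, h]
        rw [Finset.sum_congr rfl this, neg_one_geom_sum]
        simp [hj]
      rw [this]; simp

lemma nsm_A_summable {N : ℕ} (χ : DirichletCharacter ℂ N) {s : ℂ} (hs : 1 < s.re) :
    LSeriesSummable (nsmA χ) s := by
  refine LSeriesSummable_of_bounded_of_one_lt_re (m := 1) (fun n hn ↦ ?_) hs
  rw [nsmA_apply _ hn]; exact norm_le_one χ _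

lemma nsm_A_LSeries {N : ℕ} [NeZero N] (χ : DirichletCharacter ℂ N) {s : ℂ} (hs : 1 < s.re) :
    LSeries (nsmA χ) s = χ.LFunction s := by
  rw [LFunction_eq_LSeries χ hs]
  exact LSeries_congr (fun {n} hn => nsmA_apply _ hn) s

lemma nsm_zetaMul_LSeries {N : ℕ} [NeZero N] (χ : DirichletCharacter ℂ N) {s : ℂ} (hs : 1 < s.re) :
    LSeries (zetaMul χ) s = riemannZeta s * χ.LFunction s := by
  have h := ArithmeticFunction.coe_mul (ArithmeticFunction.zeta : ArithmeticFunction ℂ) (nsmA χ)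
  rw [nsm_zetaMul_eq, ← h, LSeries_convolution', nsm_A_LSeries χ hs]
  · congr 1
    simp_rw [← ArithmeticFunction.LSeries_zeta_eq_riemannZeta hs, ← ArithmeticFunction.natCoe_apply]
  · exact ArithmeticFunction.LSeriesSummable_zeta_iff.mpr hs
  · exact nsm_A_summable χ hs

lemma nsm_f_summable {N : ℕ} (α β : DirichletCharacter ℂ N) {s : ℂ} (hs : 1 < s.re) :
    LSeriesSummable (zetaMul α * (nsmA β * nsmA (α * β)) : ArithmeticFunction ℂ) s :=
  ArithmeticFunction.LSeriesSummable_mul (LSeriesSummable_zetaMul α hs)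
    (ArithmeticFunction.LSeriesSummable_mul (nsm_A_summable _ hs) (nsm_A_summable _ hs))

lemma nsm_f_LSeries {N : ℕ} [NeZero N] (α β : DirichletCharacter ℂ N) {s : ℂ} (hs : 1 < s.re) :
    LSeries (zetaMul α * (nsmA β * nsmA (α * β)) : ArithmeticFunction ℂ) s =
      riemannZeta s * (α.LFunction s * (β.LFunction s * (α * β).LFunction s)) := by
  rw [ArithmeticFunction.LSeries_mul' (LSeriesSummable_zetaMul α hs)
    (ArithmeticFunction.LSeriesSummable_mul (nsm_A_summable _ hs) (nsm_A_summable _ hs)),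
    ArithmeticFunction.LSeries_mul' (nsm_A_summable _ hs) (nsm_A_summable _ hs),
    nsm_zetaMul_LSeries α hs, nsm_A_LSeries _ hs, nsm_A_LSeries _ hs]
  ring

lemma nsm_abscissa {f : ℕ → ℂ} (h : ∀ s : ℂ, 1 < s.re → LSeriesSummable f s) :
    LSeries.abscissaOfAbsConv f ≤ 1 := by
  refine LSeries.abscissaOfAbsConv_le_of_forall_lt_LSeriesSummable (x := 1) fun y hy => h _ (by simpa using hy)

open scoped ComplexOrder in
/-- positivity of the value at one -/
lemma nsm_L_one_pos {q : ℕ} [NeZero q] {χ : DirichletCharacter ℂ q} (h2 : χ ^ 2 = 1) (h1 : χ ≠ 1) :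
    0 < (χ.LFunction 1).re ∧ χ.LFunction 1 = ((χ.LFunction 1).re : ℂ) := by
  have hr : ∀ a, (starRingEnd ℂ) (χ a) = χ a := by
    intro a
    rcases MulChar.isQuadratic_iff_sq_eq_one.mpr h2 a with h | h | h <;> rw [h] <;> simp
  have him : (χ.LFunction 1).im = 0 := by
    simpa using nsm_L_conj h1 hr (x := 1) one_pos
  have heq : χ.LFunction 1 = ((χ.LFunction 1).re : ℂ) := by
    apply Complex.ext <;> simp [him]
  refine ⟨?_, heq⟩
  have hne := LFunction_apply_one_ne_zero h1
  have hpos : ∀ x : ℝ, 1 < x → 0 ≤ (χ.LFunction x).re := by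
    intro x hx
    have hs : 1 < (x:ℂ).re := by simpa using hx
    have hA := LSeries.positive (a := zetaMul χ) (fun n => zetaMul_nonneg h2 n)
      (by rw [(isMultiplicative_zetaMul χ).map_one]; simp)
      (x := x) (lt_of_le_of_lt (nsm_abscissa fun s hs => LSeriesSummable_zetaMul χ hs)
        (by exact_mod_cast hx))
    rw [nsm_zetaMul_LSeries χ hs] at hA
    have hz := riemannZeta_pos_of_one_lt hx
    have := (Complex.pos_iff.1 hA).1
    rw [Complex.mul_re] at this
    have hz' := Complex.pos_iff.1 hz
    rw [← hz'.2] at this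
    simp only [zero_mul, sub_zero] at this
    exact (pos_of_mul_pos_right this hz'.1.le).le
  have hlim : Filter.Tendsto (fun x : ℝ => (χ.LFunction x).re) (nhdsWithin 1 (Set.Ioi 1))
      (nhds (χ.LFunction 1).re) := by
    have hc : Continuous (fun x : ℝ => (χ.LFunction x).re) :=
      Complex.continuous_re.comp ((differentiable_LFunction h1).continuous.comp Complex.continuous_ofReal)
    have := hc.tendsto 1
    simp only [Complex.ofReal_one] at this
    exact this.mono_left nhdsWithin_le_nhds
  have h0 : 0 ≤ (χ.LFunction 1).re := by
    refine ge_of_tendsto hlim ?_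
    filter_upwards [self_mem_nhdsWithin] with x hx using hpos x hx
  rcases h0.lt_or_eq with h | h
  · exact h
  · exfalso; apply hne; rw [heq, ← h]; simp

noncomputable def nsmD : ℝ := 4 * nsmZ (7/6)

lemma nsmD_one_le : 1 ≤ nsmD := by
  have := nsmZ_one_le (a := 7/6) (by norm_num)
  unfold nsmD; linarith

lemma nsm_ball {q : ℕ} [NeZero q] {χ : DirichletCharacter ℂ q} (hχ : χ ≠ 1) {s : ℂ}
    (hs : s ∈ Metric.closedBall (2 : ℂ) (4/3)) : ‖χ.LFunction s‖ ≤ nsmD * (q:ℝ) ^ (1/2 : ℝ) := by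
  rw [Metric.mem_closedBall, dist_eq_norm] at hs
  have hre : 2/3 ≤ s.re := by
    have := (abs_le.1 ((Complex.abs_re_le_norm (s - 2)).trans hs)).1
    simp at this; linarith
  have hn : ‖s‖ ≤ 4 := by
    calc ‖s‖ = ‖(s - 2) + 2‖ := by ring_nf
      _ ≤ ‖s-2‖ + ‖(2:ℂ)‖ := norm_add_le _ _
      _ ≤ 4/3 + 2 := by gcongr; simp
      _ ≤ 4 := by norm_num
  have h := nsm_L_bound hχ (θ := 1/2) (by norm_num) (by norm_num) (s := s) (by linarith) (by linarith)
  have hZ := nsmZ_anti (a := 7/6) (b := s.re + 1/2) (by norm_num) (by linarith)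
  have hZ0 := nsmZ_one_le (a := s.re + 1/2) (by linarith)
  calc _ ≤ _ := h
    _ ≤ 4 * (q:ℝ) ^ (1/2 : ℝ) * nsmZ (7/6) := by gcongr
    _ = _ := by unfold nsmD; ring

open scoped ComplexOrder in
lemma nsm_est2 : ∃ B : ℝ, 1 ≤ B ∧ ∀ (G : ℂ → ℂ) (a : ℕ → ℂ) (lam K t : ℝ),
    Differentiable ℂ G → 0 ≤ a → a 1 = 1 → LSeries.abscissaOfAbsConv a ≤ 1 →
    (∀ s : ℂ, 1 < s.re → LSeries a s = riemannZeta s * G s) →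
    G 1 = lam → 1 ≤ K → (∀ s ∈ Metric.closedBall (2 : ℂ) (4/3), ‖G s‖ ≤ K) →
    1 < t → t ≤ 9/8 → (riemannZeta ((2 - t : ℝ) : ℂ) * G ((2 - t : ℝ) : ℂ)).re ≤ 0 →
    (t - 1) / 4 * (B * K) ^ (-(8 * (t - 1))) ≤ lam := by
  obtain ⟨A, hA, h⟩ := nsm_estermann
  refine ⟨64/5 * A, by linarith, ?_⟩
  intro G a lam K t hG ha ha1 habs hL hlam hK1 hK ht1 ht2 hneg
  set X : ℝ := 64/5 * A * K with hX
  have hX1 : 1 ≤ X := by nlinarith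
  have hX0 : 0 < X := by linarith
  have hlog : 0 ≤ Real.log X := Real.log_nonneg hX1
  set M : ℕ := ⌈8 * Real.log X⌉₊ + 1 with hM
  have hM1 : 8 * Real.log X ≤ M := by
    have := Nat.le_ceil (8 * Real.log X)
    rw [hM]; push_cast; linarith
  have hM2 : (M:ℝ) ≤ 8 * Real.log X + 2 := by
    have := Nat.ceil_lt_add_one (a := 8 * Real.log X) (by positivity)
    rw [hM]; push_cast; linarith
  have key := h G a lam K t hG ha ha1 habs hL hlam hK ht1 ht2 hneg M (by omega)
  have e1 : ((27:ℝ)/32) ^ M ≤ 1 / X := by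
    have h1 : (27:ℝ)/32 ≤ Real.exp (-(5/32)) := by
      have := Real.add_one_le_exp (-(5/32) : ℝ); linarith
    calc ((27:ℝ)/32) ^ M ≤ (Real.exp (-(5/32))) ^ M := by gcongr
      _ = Real.exp (M * (-(5/32))) := by rw [Real.exp_nat_mul]
      _ ≤ Real.exp (- Real.log X) := by
          apply Real.exp_le_exp.2; linarith
      _ = 1 / X := by rw [Real.exp_neg, Real.exp_log hX0, one_div]
  have e2 : t ^ M ≤ 2 * X ^ (8 * (t-1)) := by
    have h1 : t ≤ Real.exp (t - 1) := by
      have := Real.add_one_le_exp (t-1); linarith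
    calc t ^ M ≤ (Real.exp (t-1)) ^ M := by gcongr
      _ = Real.exp (M * (t-1)) := by rw [Real.exp_nat_mul]
      _ ≤ Real.exp (Real.log 2 + Real.log X * (8 * (t-1))) := by
          apply Real.exp_le_exp.2
          have := Real.log_two_gt_d9
          nlinarith
      _ = _ := by rw [Real.exp_add, Real.exp_log two_pos, Real.rpow_def_of_pos hX0]
  have e3 : 32/5 * (A*K) * (27/32)^M ≤ 1/2 := by
    calc 32/5 * (A*K) * (27/32)^M = X/2 * (27/32)^M := by rw [hX]; ring
      _ ≤ X/2 * (1/X) := by gcongr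
      _ = 1/2 := by field_simp
  have e4 : 1/2 ≤ lam * t^M/(t-1) := by linarith
  have ht0 : 0 < t - 1 := by linarith
  rw [le_div_iff₀ ht0] at e4
  have htM : 0 < t ^ M := by positivity
  have hlam0 : 0 < lam := pos_of_mul_pos_left (lt_of_lt_of_le (by positivity) e4) htM.le
  have hY : 0 < X ^ (8 * (t-1)) := by positivity
  have e5 : (t-1)/2 ≤ lam * (2 * X ^ (8 * (t-1))) := by
    have := mul_le_mul_of_nonneg_left e2 hlam0.le; linarith
  rw [Real.rpow_neg hX0.le, ← div_eq_mul_inv, div_le_iff₀ hY]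
  linarith

open scoped ComplexOrder in
lemma nsm_est3 : ∃ c : ℝ, 0 < c ∧ ∀ (N : ℕ) (G : ℂ → ℂ) (a : ℕ → ℂ) (lam t : ℝ), 1 ≤ N →
    Differentiable ℂ G → 0 ≤ a → a 1 = 1 → LSeries.abscissaOfAbsConv a ≤ 1 →
    (∀ s : ℂ, 1 < s.re → LSeries a s = riemannZeta s * G s) →
    G 1 = lam → (∀ s ∈ Metric.closedBall (2 : ℂ) (4/3), ‖G s‖ ≤ (nsmD * (N:ℝ) ^ (1/2 : ℝ)) ^ 3) →
    1 < t → t ≤ 1 + 1/200 → (riemannZeta ((2 - t : ℝ) : ℂ) * G ((2 - t : ℝ) : ℂ)).re ≤ 0 →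
    c * (t - 1) * (N:ℝ) ^ (-(1/16) : ℝ) ≤ lam := by
  obtain ⟨B, hB, h⟩ := nsm_est2
  have hD := nsmD_one_le
  have hBD : 1 ≤ B * nsmD ^ 3 := one_le_mul_of_one_le_of_one_le hB (one_le_pow₀ hD)
  refine ⟨1/4 * (B * nsmD ^ 3)⁻¹, by positivity, ?_⟩
  intro N G a lam t hN hG ha ha1 habs hL hlam hK ht1 ht2 hneg
  have hN1 : (1:ℝ) ≤ N := by exact_mod_cast hN
  have hN0 : (0:ℝ) < N := by linarith
  have hK1 : 1 ≤ (nsmD * (N:ℝ) ^ (1/2 : ℝ)) ^ 3 :=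
    one_le_pow₀ (one_le_mul_of_one_le_of_one_le hD (Real.one_le_rpow hN1 (by norm_num)))
  have key := h G a lam _ t hG ha ha1 habs hL hlam hK1 hK ht1 (by linarith) hneg
  refine le_trans ?_ key
  have e0 : B * (nsmD * (N:ℝ) ^ (1/2 : ℝ)) ^ 3 = (B * nsmD ^ 3) * (N:ℝ) ^ (3/2 : ℝ) := by
    rw [mul_pow, ← Real.rpow_natCast ((N:ℝ) ^ (1/2 : ℝ)), ← Real.rpow_mul hN0.le]
    norm_num; ring
  rw [e0, Real.mul_rpow (by linarith) (by positivity), ← Real.rpow_mul hN0.le]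
  have e1 : (B * nsmD ^ 3)⁻¹ ≤ (B * nsmD ^ 3) ^ (-(8 * (t - 1))) := by
    rw [← Real.rpow_neg_one]
    exact Real.rpow_le_rpow_of_exponent_le hBD (by linarith)
  have e2 : (N:ℝ) ^ (-(1/16) : ℝ) ≤ (N:ℝ) ^ (3/2 * (-(8 * (t - 1))) : ℝ) :=
    Real.rpow_le_rpow_of_exponent_le hN1 (by linarith)
  have ht0 : 0 < t - 1 := by linarith
  calc _ = (t-1)/4 * ((B * nsmD ^ 3)⁻¹ * (N:ℝ) ^ (-(1/16) : ℝ)) := by ring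
    _ ≤ _ := by gcongr

/-- zeta is negative slightly to the left of one -/
lemma nsm_zeta_neg : ∃ e : ℝ, 0 < e ∧ e ≤ 1/200 ∧ (riemannZeta ((1 - e : ℝ) : ℂ)).re ≤ 0 := by
  set h := LFunctionTrivChar₁ 1 with hh
  have hhd : Differentiable ℂ h := differentiable_LFunctionTrivChar₁ 1
  have hh1 : h 1 = 1 := by simp [hh, LFunctionTrivChar₁]
  have hhne : ∀ s : ℂ, s ≠ 1 → h s = (s - 1) * riemannZeta s := by
    intro s hs
    simp only [hh, LFunctionTrivChar₁]
    rw [Function.update_of_ne hs, LFunctionTrivChar, LFunction_modOne_eq]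
  have hc : Continuous (fun x : ℝ => (h ((1 - x : ℝ) : ℂ)).re) :=
    Complex.continuous_re.comp (hhd.continuous.comp (Complex.continuous_ofReal.comp (by fun_prop)))
  have hev : ∀ᶠ x : ℝ in nhds 0, 0 < (h ((1 - x : ℝ) : ℂ)).re := by
    have := hc.tendsto 0
    simp only [sub_zero, Complex.ofReal_one, hh1, Complex.one_re] at this
    exact this.eventually (lt_mem_nhds one_pos)
  obtain ⟨δ, hδ, H⟩ := Metric.eventually_nhds_iff.1 hev
  refine ⟨min (δ/2) (1/200), by positivity, min_le_right _ _, ?_⟩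
  set e := min (δ/2) (1/200) with he
  have he0 : 0 < e := by positivity
  have h1 : e ≤ δ/2 := min_le_left _ _
  have h2 := H (y := e) (by rw [Real.dist_eq, sub_zero, abs_of_pos he0]; linarith)
  rw [hhne _ (by rw [← Complex.ofReal_one, Ne, Complex.ofReal_inj]; linarith)] at h2
  have h3 : (((1 - e : ℝ) : ℂ) - 1) = ((-e : ℝ) : ℂ) := by push_cast; ring
  rw [h3, Complex.re_ofReal_mul] at h2
  nlinarith

lemma nsm_real {q : ℕ} {χ : DirichletCharacter ℂ q} (h2 : χ ^ 2 = 1) (a : ZMod q) :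
    (starRingEnd ℂ) (χ a) = χ a := by
  rcases MulChar.isQuadratic_iff_sq_eq_one.mpr h2 a with h | h | h <;> rw [h] <;> simp

lemma nsm_le_cube {x : ℝ} (hx : 1 ≤ x) : x ≤ x ^ 3 := le_self_pow₀ hx (by norm_num)

lemma nsm_DN {q : ℕ} [NeZero q] : 1 ≤ nsmD * (q:ℝ) ^ (1/2 : ℝ) :=
  one_le_mul_of_one_le_of_one_le nsmD_one_le
    (Real.one_le_rpow (by exact_mod_cast NeZero.one_le) (by norm_num))

/-- first case -/
lemma nsm_case1 : ∃ c : ℝ, 0 < c ∧ ∀ (e : ℝ) (q : ℕ) [NeZero q] (χ : DirichletCharacter ℂ q),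
    0 < e → e ≤ 1/200 → (riemannZeta ((1 - e : ℝ) : ℂ)).re ≤ 0 → χ ^ 2 = 1 → χ ≠ 1 →
    0 ≤ (χ.LFunction ((1 - e : ℝ) : ℂ)).re →
    c * e * (q:ℝ) ^ (-(1/16) : ℝ) ≤ ‖χ.LFunction 1‖ := by
  obtain ⟨c, hc, h⟩ := nsm_est3
  refine ⟨c, hc, ?_⟩
  intro e q _ χ he0 he1 hz h2 h1 hL
  obtain ⟨hp, heq⟩ := nsm_L_one_pos h2 h1
  have key := h q χ.LFunction (zetaMul χ) (χ.LFunction 1).re (1 + e) NeZero.one_le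
    (differentiable_LFunction h1) (fun n => zetaMul_nonneg h2 n) (isMultiplicative_zetaMul χ).map_one
    (nsm_abscissa fun s hs => LSeriesSummable_zetaMul χ hs)
    (fun s hs => nsm_zetaMul_LSeries χ hs) heq
    (fun s hs => (nsm_ball h1 hs).trans (nsm_le_cube nsm_DN)) (by linarith) (by linarith)
    (by
      have him := nsm_L_conj h1 (nsm_real h2) (x := 1 - e) (by linarith)
      rw [show 2 - (1 + e) = 1 - e by ring, Complex.mul_re, him, mul_zero, sub_zero]
      exact mul_nonpos_of_nonpos_of_nonneg hz hL)
  rw [show 1 + e - 1 = e by ring] at key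
  exact key.trans ((le_abs_self _).trans (Complex.abs_re_le_norm _))

/-- second case at a common level -/
lemma nsm_case2 : ∃ c : ℝ, 0 < c ∧ ∀ (x : ℝ) (N : ℕ) [NeZero N] (α β : DirichletCharacter ℂ N),
    x < 1 → 1 - 1/200 ≤ x → α ^ 2 = 1 → β ^ 2 = 1 → α ≠ 1 → β ≠ 1 → α * β ≠ 1 →
    α.LFunction (x : ℂ) = 0 →
    c * (1 - x) * (N:ℝ) ^ (-(3/16) : ℝ) ≤ ‖β.LFunction 1‖ := by
  obtain ⟨c, hc, h⟩ := nsm_est3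
  obtain ⟨C, hC, hCb⟩ := nsm_L_bounds (1/16) (by norm_num) (by norm_num)
  refine ⟨c / C ^ 2, by positivity, ?_⟩
  intro x N _ α β hx1 hx2 hα2 hβ2 hα hβ hαβ hL
  have hαβ2 : (α * β) ^ 2 = 1 := by rw [mul_pow, hα2, hβ2, one_mul]
  obtain ⟨hp1, heq1⟩ := nsm_L_one_pos hα2 hα
  obtain ⟨hp2, heq2⟩ := nsm_L_one_pos hβ2 hβ
  obtain ⟨hp3, heq3⟩ := nsm_L_one_pos hαβ2 hαβ
  have hN1 : (1:ℝ) ≤ N := by exact_mod_cast NeZero.one_le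
  have hN0 : (0:ℝ) < N := by linarith
  have key := h N (fun s => α.LFunction s * (β.LFunction s * (α * β).LFunction s))
    (zetaMul α * (nsmA β * nsmA (α * β)) : ArithmeticFunction ℂ)
    ((α.LFunction 1).re * ((β.LFunction 1).re * ((α * β).LFunction 1).re)) (1 + (1 - x)) NeZero.one_le
    ((differentiable_LFunction hα).mul ((differentiable_LFunction hβ).mul (differentiable_LFunction hαβ)))
    (fun n => nsm_f_nonneg hα2 hβ2 n)
    ((isMultiplicative_zetaMul α).mul ((nsmA_mult β).mul (nsmA_mult _))).map_one
    (nsm_abscissa fun s hs => nsm_f_summable α β hs)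
    (fun s hs => nsm_f_LSeries α β hs) (by
      push_cast
      rw [← heq1, ← heq2, ← heq3])
    (fun s hs => by
      rw [norm_mul, norm_mul, pow_three]
      have a1 := nsm_ball hα hs
      have a2 := nsm_ball hβ hs
      have a3 := nsm_ball hαβ hs
      have a4 : 0 ≤ nsmD * (N:ℝ) ^ (1/2 : ℝ) := (norm_nonneg _).trans a1
      gcongr) (by linarith) (by linarith)
    (by
      rw [show 2 - (1 + (1 - x)) = x by ring, hL]
      simp)
  have b1 : ∀ χ : DirichletCharacter ℂ N, χ ≠ 1 → (χ.LFunction 1).re ≤ C * (N:ℝ) ^ (1/16 : ℝ) := by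
    intro χ hχ
    have := (hCb N χ hχ 0 le_rfl zero_le_one).1
    simp only [Complex.ofReal_zero, add_zero] at this
    exact (Complex.re_le_norm _).trans this
  have b2 : (α.LFunction 1).re * ((β.LFunction 1).re * ((α * β).LFunction 1).re) ≤
      (C * (N:ℝ) ^ (1/16 : ℝ)) * ((β.LFunction 1).re * (C * (N:ℝ) ^ (1/16 : ℝ))) := by
    have := b1 α hα
    have := b1 _ hαβ
    gcongr
  have b3 : (N:ℝ) ^ (-(3/16) : ℝ) = (N:ℝ) ^ (-(1/16) : ℝ) * ((N:ℝ) ^ (1/16 : ℝ))⁻¹ * ((N:ℝ) ^ (1/16 : ℝ))⁻¹ := by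
    rw [← Real.rpow_neg hN0.le, ← Real.rpow_add hN0, ← Real.rpow_add hN0]; norm_num
  refine le_trans ?_ (Complex.re_le_norm _)
  rw [show 1 + (1 - x) - 1 = 1 - x by ring] at key
  have hY : 0 < (N:ℝ) ^ (1/16 : ℝ) := by positivity
  rw [b3]
  calc _ = (c * (1 - x) * (N:ℝ) ^ (-(1/16) : ℝ)) / (C * (N:ℝ) ^ (1/16 : ℝ)) ^ 2 := by
        field_simp
    _ ≤ _ := by
        rw [div_le_iff₀ (by positivity)]
        calc _ ≤ _ := key.trans b2
          _ = _ := by ring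

lemma nsm_prod_lower (S : Finset ℕ) (hS : ∀ m ∈ S, 2 ≤ m) :
    1 / ((S.card : ℝ) + 1) ≤ ∏ m ∈ S, (1 - 1 / (m:ℝ)) := by
  induction S using Finset.induction_on_max with
  | empty => simp
  | insert a S ha ih =>
    have hna : a ∉ S := fun h => lt_irrefl _ (ha a h)
    rw [Finset.prod_insert hna, Finset.card_insert_of_notMem hna]
    have ih' := ih fun m hm => hS m (Finset.mem_insert_of_mem hm)
    have ha2 := hS a (Finset.mem_insert_self _ _)
    have hcard : S.card + 2 ≤ a := by
      have : S ⊆ Finset.Ico 2 a := fun m hm =>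
        Finset.mem_Ico.2 ⟨hS m (Finset.mem_insert_of_mem hm), ha m hm⟩
      have := Finset.card_le_card this
      rw [Nat.card_Ico] at this
      omega
    have hc' : (S.card : ℝ) + 2 ≤ a := by exact_mod_cast hcard
    have h1 : 1 - 1 / ((S.card : ℝ) + 2) ≤ 1 - 1 / (a:ℝ) := by
      gcongr
    have h0 : 0 ≤ 1 - 1 / ((S.card : ℝ) + 2) := by
      rw [sub_nonneg, div_le_one (by positivity)]
      have : (0:ℝ) ≤ S.card := by positivity
      linarith
    calc _ = (1 - 1 / ((S.card : ℝ) + 2)) * (1 / ((S.card : ℝ) + 1)) := by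
          push_cast; field_simp; ring
      _ ≤ _ := mul_le_mul h1 ih' (by positivity) (h0.trans h1)

lemma nsm_omega (N : ℕ) (hN : N ≠ 0) : (N.primeFactors.card : ℝ) + 1 ≤ 16 * (N:ℝ) ^ (1/8 : ℝ) := by
  have h1 : 2 ^ N.primeFactors.card ≤ N := by
    calc 2 ^ N.primeFactors.card ≤ ∏ p ∈ N.primeFactors, p :=
          Finset.pow_card_le_prod _ _ _ fun p hp => (Nat.prime_of_mem_primeFactors hp).two_le
      _ ≤ N := Nat.le_of_dvd (Nat.pos_of_ne_zero hN) (Nat.prod_primeFactors_dvd N)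
  have h2 : ((2:ℝ) ^ N.primeFactors.card) ≤ N := by exact_mod_cast h1
  have h3 : ((2:ℝ) ^ N.primeFactors.card) ^ (1/8 : ℝ) ≤ (N:ℝ) ^ (1/8 : ℝ) := by gcongr
  rw [← Real.rpow_natCast, ← Real.rpow_mul (by norm_num), Real.rpow_def_of_pos (by norm_num)] at h3
  have h4 := Real.add_one_le_exp (Real.log 2 * ((N.primeFactors.card : ℝ) * (1/8)))
  have h5 := Real.log_two_gt_d9
  have h6 : (0:ℝ) ≤ N.primeFactors.card := by positivity
  nlinarith

lemma nsm_euler_upper {q1 q : ℕ} [NeZero q] (χ : DirichletCharacter ℂ q) :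
    ‖∏ p ∈ (q1 * q).primeFactors, (1 - χ p * (p:ℂ) ^ (-(1:ℂ)))‖ ≤ 2 ^ q1.primeFactors.card := by
  rw [norm_prod]
  calc ∏ p ∈ (q1 * q).primeFactors, ‖1 - χ p * (p:ℂ) ^ (-(1:ℂ))‖
      ≤ ∏ p ∈ (q1 * q).primeFactors, (if p ∈ q1.primeFactors then (2:ℝ) else 1) := by
        refine Finset.prod_le_prod (fun _ _ => norm_nonneg _) fun p hp => ?_
        have hpp := Nat.prime_of_mem_primeFactors hp
        split_ifs with h
        · calc _ ≤ ‖(1:ℂ)‖ + ‖χ p * (p:ℂ) ^ (-(1:ℂ))‖ := norm_sub_le _ _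
            _ ≤ 1 + 1 * 1 := by
              rw [norm_mul, norm_one]
              gcongr
              · exact norm_le_one χ _
              · rw [Complex.cpow_neg_one, norm_inv, Complex.norm_natCast]
                exact inv_le_one_of_one_le₀ (by exact_mod_cast hpp.one_le)
            _ = 2 := by norm_num
        · have hq0 : q ≠ 0 := NeZero.ne q
          have hdvd : p ∣ q := by
            have h1 := Nat.dvd_of_mem_primeFactors hp
            rcases hpp.dvd_mul.1 h1 with h2 | h2
            · exfalso; apply h
              have h3 := (Nat.mem_primeFactors.1 hp).2.2
              exact Nat.mem_primeFactors.2 ⟨hpp, h2, fun h4 => h3 (by simp [h4])⟩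
            · exact h2
          have : χ p = 0 := by
            apply MulChar.map_nonunit
            rw [ZMod.isUnit_iff_coprime]
            intro hc
            exact hpp.one_lt.ne' (Nat.eq_one_of_dvd_coprimes hc dvd_rfl hdvd)
          rw [this]; simp
    _ = 2 ^ ((q1 * q).primeFactors ∩ q1.primeFactors).card := by
        rw [Finset.prod_ite_mem, Finset.prod_const]
    _ ≤ _ := by
        gcongr
        · norm_num
        · exact Finset.inter_subset_right

lemma nsm_euler_lower {q1 N : ℕ} (χ : DirichletCharacter ℂ q1) (hN : N ≠ 0) :
    1 / (16 * (N:ℝ) ^ (1/8 : ℝ)) ≤ ‖∏ p ∈ N.primeFactors, (1 - χ p * (p:ℂ) ^ (-(1:ℂ)))‖ := by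
  calc 1 / (16 * (N:ℝ) ^ (1/8 : ℝ)) ≤ 1 / ((N.primeFactors.card : ℝ) + 1) := by
        have := nsm_omega N hN
        gcongr
    _ ≤ ∏ m ∈ N.primeFactors, (1 - 1 / (m:ℝ)) :=
        nsm_prod_lower _ fun m hm => (Nat.prime_of_mem_primeFactors hm).two_le
    _ ≤ _ := by
        rw [norm_prod]
        refine Finset.prod_le_prod (fun p hp => ?_) fun p hp => ?_
        · have hpp := (Nat.prime_of_mem_primeFactors hp).one_le
          rw [sub_nonneg, div_le_one (by exact_mod_cast hpp)]
          exact_mod_cast hpp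
        · have h1 := norm_sub_norm_le (1:ℂ) (χ p * (p:ℂ) ^ (-(1:ℂ)))
          have h2 : ‖χ p * (p:ℂ) ^ (-(1:ℂ))‖ ≤ 1 * (1 / (p:ℝ)) := by
            rw [norm_mul]
            gcongr
            · exact norm_le_one χ _
            · rw [Complex.cpow_neg_one, norm_inv, Complex.norm_natCast, one_div]
          rw [norm_one] at h1
          linarith

/-- Siegel theorem with exponent 1/4 -/
lemma nsm_siegel : ∃ c : ℝ, 0 < c ∧ ∀ (q : ℕ) [NeZero q] (χ : DirichletCharacter ℂ q),
    χ ^ 2 = 1 → χ ≠ 1 → c * (q:ℝ) ^ (-(1/4) : ℝ) ≤ ‖χ.LFunction 1‖ := by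
  obtain ⟨e, he0, he1, hz⟩ := nsm_zeta_neg
  by_cases hcase : ∀ (q : ℕ) [NeZero q] (χ : DirichletCharacter ℂ q), χ ^ 2 = 1 → χ ≠ 1 →
      0 ≤ (χ.LFunction ((1 - e : ℝ) : ℂ)).re
  · obtain ⟨c, hc, h⟩ := nsm_case1
    refine ⟨c * e, by positivity, fun q _ χ h2 h1 => ?_⟩
    refine le_trans ?_ (h e q χ he0 he1 hz h2 h1 (hcase q χ h2 h1))
    have hq1 : (1:ℝ) ≤ q := by exact_mod_cast NeZero.one_le
    gcongr
    norm_num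
  · push Not at hcase
    obtain ⟨q1, _, χ1, h12, h11, hneg⟩ := hcase
    obtain ⟨hp, heq⟩ := nsm_L_one_pos h12 h11
    have hcont : Continuous (fun x : ℝ => (χ1.LFunction x).re) :=
      Complex.continuous_re.comp ((differentiable_LFunction h11).continuous.comp Complex.continuous_ofReal)
    obtain ⟨b, hb, hb0⟩ : ∃ b ∈ Set.Icc (1 - e) 1, (χ1.LFunction (b:ℂ)).re = 0 := by
      have := intermediate_value_Icc (show 1 - e ≤ 1 by linarith) hcont.continuousOn
      exact this ⟨hneg.le, by simpa using hp.le⟩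
    have hb1 : b < 1 := by
      refine lt_of_le_of_ne hb.2 ?_
      rintro rfl
      rw [Complex.ofReal_one] at hb0
      exact hp.ne' hb0
    have hbL : χ1.LFunction (b:ℂ) = 0 := by
      apply Complex.ext
      · simpa using hb0
      · simpa using nsm_L_conj h11 (nsm_real h12) (x := b) (by linarith [hb.1])
    obtain ⟨c, hc, h⟩ := nsm_case2
    have hL1 : 0 < ‖χ1.LFunction 1‖ := norm_pos_iff.2 (LFunction_apply_one_ne_zero h11)
    have hq1 : (1:ℝ) ≤ q1 := by exact_mod_cast NeZero.one_le
    set k := q1.primeFactors.card with hk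
    refine ⟨min (c * (1 - b)) (‖χ1.LFunction 1‖ / 16) * (q1:ℝ) ^ (-(1/4) : ℝ) / 2 ^ k,
      by have : 0 < 1 - b := by linarith
         positivity, fun q _ χ h2 h1 => ?_⟩
    have hq : (1:ℝ) ≤ q := by exact_mod_cast NeZero.one_le
    have hN0 : q1 * q ≠ 0 := mul_ne_zero (NeZero.ne _) (NeZero.ne _)
    have : NeZero (q1 * q) := ⟨hN0⟩
    have hN1 : (1:ℝ) ≤ ((q1 * q : ℕ) : ℝ) := by exact_mod_cast NeZero.one_le
    set ψ1 := changeLevel (Dvd.intro q rfl : q1 ∣ q1 * q) χ1 with hψ1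
    set ψ := changeLevel (Dvd.intro_left q1 rfl : q ∣ q1 * q) χ with hψ
    have hψ12 : ψ1 ^ 2 = 1 := by rw [hψ1, ← map_pow, h12, map_one]
    have hψ2 : ψ ^ 2 = 1 := by rw [hψ, ← map_pow, h2, map_one]
    have hψan : ψ1 ≠ 1 := by rwa [hψ1, Ne, changeLevel_eq_one_iff]
    have hψn : ψ ≠ 1 := by rwa [hψ, Ne, changeLevel_eq_one_iff]
    have e1 : ψ.LFunction 1 = χ.LFunction 1 * ∏ p ∈ (q1 * q).primeFactors, (1 - χ p * (p:ℂ) ^ (-(1:ℂ))) :=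
      LFunction_changeLevel _ χ (.inl h1)
    have e2 : ∀ s, ψ1.LFunction s = χ1.LFunction s *
        ∏ p ∈ (q1 * q).primeFactors, (1 - χ1 p * (p:ℂ) ^ (-s)) :=
      fun s => LFunction_changeLevel _ χ1 (.inl h11)
    have e3 : ‖ψ.LFunction 1‖ ≤ ‖χ.LFunction 1‖ * 2 ^ k := by
      rw [e1, norm_mul]
      gcongr
      exact nsm_euler_upper χ
    have e4 : (((q1 * q : ℕ) : ℝ)) ^ (-(1/4) : ℝ) = (q1:ℝ) ^ (-(1/4) : ℝ) * (q:ℝ) ^ (-(1/4) : ℝ) := by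
      push_cast
      rw [Real.mul_rpow (by positivity) (by positivity)]
    have main : min (c * (1 - b)) (‖χ1.LFunction 1‖ / 16) * (((q1 * q : ℕ) : ℝ)) ^ (-(1/4) : ℝ) ≤
        ‖ψ.LFunction 1‖ := by
      by_cases hprod : ψ1 * ψ = 1
      · have hψeq : ψ = ψ1 := by
          have : ψ1 * ψ1 = 1 := by rw [← sq, hψ12]
          exact mul_left_cancel (hprod.trans this.symm)
        rw [hψeq, e2, norm_mul]
        calc _ ≤ ‖χ1.LFunction 1‖ / 16 * (((q1 * q : ℕ) : ℝ)) ^ (-(1/8) : ℝ) := by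
              gcongr
              · exact min_le_right _ _
              · norm_num
          _ = ‖χ1.LFunction 1‖ * (1 / (16 * (((q1 * q : ℕ) : ℝ)) ^ (1/8 : ℝ))) := by
              rw [Real.rpow_neg (by positivity)]; field_simp
          _ ≤ _ := by
              gcongr
              exact nsm_euler_lower χ1 hN0
      · have := h b (q1 * q) ψ1 ψ hb1 (by linarith [hb.1]) hψ12 hψ2 hψan hψn hprod
          (by rw [e2, hbL, zero_mul])
        refine le_trans ?_ this
        have : 0 < 1 - b := by linarith
        have h7 : (((q1 * q : ℕ) : ℝ)) ^ (-(1/4) : ℝ) ≤ (((q1 * q : ℕ) : ℝ)) ^ (-(3/16) : ℝ) :=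
          Real.rpow_le_rpow_of_exponent_le hN1 (by norm_num)
        exact mul_le_mul (min_le_left _ _) h7 (by positivity) (by positivity)
    rw [e4] at main
    have hk2 : (0:ℝ) < 2 ^ k := by positivity
    have := main.trans e3
    rw [div_mul_eq_mul_div, div_le_iff₀ hk2]
    linarith

/-- uniform lower bound for all nonprincipal characters -/
lemma nsm_lower : ∃ c : ℝ, 0 < c ∧ ∀ (q : ℕ) [NeZero q] (χ : DirichletCharacter ℂ q),
    χ ≠ 1 → c * (q:ℝ) ^ (-(1/4) : ℝ) ≤ ‖χ.LFunction 1‖ := by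
  obtain ⟨c1, hc1, h1⟩ := nsm_siegel
  obtain ⟨c2, hc2, h2⟩ := nsm_complex
  refine ⟨min c1 c2, by positivity, fun q _ χ hχ => ?_⟩
  by_cases h : χ ^ 2 = 1
  · refine le_trans ?_ (h1 q χ h hχ)
    gcongr; exact min_le_left _ _
  · refine le_trans ?_ (h2 q χ h)
    gcongr; exact min_le_right _ _

lemma nsm_conj_char {q : ℕ} [NeZero q] (χ : DirichletCharacter ℂ q) {a : ZMod q} (ha : IsUnit a) :
    (starRingEnd ℂ) (χ a) = χ a⁻¹ := by
  have h1 : χ a⁻¹ * χ a = 1 := by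
    rw [← map_mul, ZMod.inv_mul_of_unit a ha, map_one]
  have h2 : ‖χ a‖ = 1 := by
    obtain ⟨u, rfl⟩ := ha
    exact DirichletCharacter.unit_norm_eq_one χ u
  rw [eq_inv_of_mul_eq_one_left h1, Complex.inv_eq_conj h2]

open scoped Classical in
lemma nsm_parseval {q : ℕ} [NeZero q] (W : ZMod q → ℝ) :
    ∑ χ : DirichletCharacter ℂ q, ‖∑ a, χ a * (W a : ℂ)‖ ^ 2 =
      q.totient * ∑ a : ZMod q, if IsUnit a then W a ^ 2 else 0 := by
  rw [← Complex.ofReal_inj]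
  push_cast
  have h1 : ∀ χ : DirichletCharacter ℂ q, ((‖∑ a, χ a * (W a : ℂ)‖ : ℂ)) ^ 2 =
      ∑ a : ZMod q, ∑ b : ZMod q, (if IsUnit a then (W a : ℂ) * W b * (χ a⁻¹ * χ b) else 0) := by
    intro χ
    rw [← Complex.conj_mul', map_sum, Finset.sum_mul_sum]
    refine Finset.sum_congr rfl fun a _ => Finset.sum_congr rfl fun b _ => ?_
    split_ifs with ha
    · rw [map_mul, nsm_conj_char χ ha, Complex.conj_ofReal]; ring
    · rw [χ.map_nonunit ha]; simp
  simp_rw [h1]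
  rw [Finset.sum_comm, Finset.mul_sum]
  refine Finset.sum_congr rfl fun a _ => ?_
  rw [Finset.sum_comm]
  split_ifs with ha
  · have h2 : ∀ b : ZMod q, ∑ χ : DirichletCharacter ℂ q, (W a : ℂ) * W b * (χ a⁻¹ * χ b) =
        if a = b then (W a : ℂ) * W b * q.totient else 0 := by
      intro b
      rw [← Finset.mul_sum, DirichletCharacter.sum_char_inv_mul_char_eq ℂ ha b]
      split_ifs <;> simp
    simp_rw [h2]
    rw [Finset.sum_ite_eq]
    simp
    ring
  · simp

noncomputable def nsmu (δ : ℝ) (n : ℕ) : ℝ := (ArithmeticFunction.moebius n : ℝ) * (n:ℝ) ^ (-(1 + δ))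

lemma nsmu_abs (δ : ℝ) (n : ℕ) : |nsmu δ n| ≤ (n:ℝ) ^ (-(1+δ)) := by
  unfold nsmu
  rw [abs_mul, abs_of_nonneg (Real.rpow_nonneg (Nat.cast_nonneg n) _)]
  have : |(ArithmeticFunction.moebius n : ℝ)| ≤ 1 := by
    exact_mod_cast ArithmeticFunction.abs_moebius_le_one (n := n)
  calc _ ≤ 1 * (n:ℝ) ^ (-(1+δ)) := by gcongr
    _ = _ := one_mul _

lemma nsm_z_summable {δ : ℝ} (hδ : 0 < δ) : Summable (fun n : ℕ => (n:ℝ) ^ (-(1+δ))) :=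
  Real.summable_nat_rpow.2 (by linarith)

lemma nsm_z_tsum {δ : ℝ} (hδ : 0 < δ) : ∑' n : ℕ, (n:ℝ) ^ (-(1+δ)) = nsmZ (1 + δ) := by
  rw [(nsm_z_summable hδ).tsum_eq_zero_add, nsmZ]
  rw [Nat.cast_zero, Real.zero_rpow (by linarith), zero_add]

lemma nsmu_summable {δ : ℝ} (hδ : 0 < δ) : Summable (nsmu δ) :=
  Summable.of_norm_bounded (nsm_z_summable hδ) fun n => nsmu_abs δ n

noncomputable def nsmM (δ : ℝ) (q : ℕ) (a : ZMod q) : ℝ := ∑' m : ℕ, nsmu δ (a.val + q * m)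

lemma nsm_inv_L {δ : ℝ} (hδ : 0 < δ) {q : ℕ} [NeZero q] (χ : DirichletCharacter ℂ q) :
    (χ.LFunction (1 + δ))⁻¹ = ∑ a, χ a * (nsmM δ q a : ℂ) := by
  have hs : 1 < ((1:ℂ) + δ).re := by simp [hδ]
  have h1 := DirichletCharacter.LSeries.mul_mu_eq_one χ hs
  rw [LFunction_eq_LSeries χ hs, ← eq_inv_of_mul_eq_one_right h1]
  have hterm : ∀ n : ℕ, LSeries.term ((fun n : ℕ => χ n) * fun n : ℕ => ((ArithmeticFunction.moebius n : ℤ) : ℂ)) (1 + δ) n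
      = χ n * (nsmu δ n : ℂ) := by
    intro n
    rcases eq_or_ne n 0 with rfl | hn
    · simp [nsmu]
    · rw [LSeries.term_of_ne_zero hn, nsmu]
      push_cast
      rw [Complex.ofReal_cpow (Nat.cast_nonneg n), div_eq_mul_inv, ← Complex.cpow_neg]
      simp only [Pi.mul_apply]
      push_cast
      ring
  have hsum : Summable (fun n : ℕ => χ n * (nsmu δ n : ℂ)) := by
    refine Summable.of_norm_bounded (nsm_z_summable hδ) fun n => ?_
    rw [norm_mul, Complex.norm_real, Real.norm_eq_abs]
    calc _ ≤ 1 * |nsmu δ n| := by gcongr; exact norm_le_one χ _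
      _ ≤ _ := by rw [one_mul]; exact nsmu_abs δ n
  rw [LSeries]
  simp_rw [hterm]
  rw [Nat.sumByResidueClasses hsum q]
  refine Finset.sum_congr rfl fun a _ => ?_
  rw [nsmM, Complex.ofReal_tsum, ← tsum_mul_left]
  refine tsum_congr fun m => ?_
  simp

open scoped Classical in
lemma nsm_T_eq {δ : ℝ} (hδ : 0 < δ) {q : ℕ} [NeZero q] :
    (∑ χ : DirichletCharacter ℂ q, if χ.Odd then 1 / ‖χ.LFunction (1 + δ)‖ ^ 2 else 0) =
      (q.totient : ℝ) * ∑ a : ZMod q, if IsUnit a then ((nsmM δ q a - nsmM δ q (-a)) / 2) ^ 2 else 0 := by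
  rw [← nsm_parseval]
  refine Finset.sum_congr rfl fun χ _ => ?_
  have hneg : ∑ a, χ (-a) * (nsmM δ q (-a) : ℂ) = ∑ a, χ a * (nsmM δ q a : ℂ) :=
    Equiv.sum_comp (Equiv.neg (ZMod q)) (fun a => χ a * (nsmM δ q a : ℂ))
  have hsp : ∑ a, χ a * (((nsmM δ q a - nsmM δ q (-a)) / 2 : ℝ) : ℂ) =
      (∑ a, χ a * (nsmM δ q a : ℂ) - ∑ a, χ a * (nsmM δ q (-a) : ℂ)) / 2 := by
    rw [← Finset.sum_sub_distrib, Finset.sum_div]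
    refine Finset.sum_congr rfl fun a _ => ?_
    push_cast; ring
  rw [hsp]
  split_ifs with ho
  · have h2 : ∑ a, χ a * (nsmM δ q (-a) : ℂ) = - ∑ a, χ a * (nsmM δ q a : ℂ) := by
      rw [← hneg, ← Finset.sum_neg_distrib]
      refine Finset.sum_congr rfl fun a _ => ?_
      rw [Odd.eval_neg χ a ho]; ring
    rw [h2, sub_neg_eq_add, add_self_div_two, ← nsm_inv_L hδ, norm_inv, inv_pow, one_div]
  · have he : χ.Even := (even_or_odd χ).resolve_right ho
    have h2 : ∑ a, χ a * (nsmM δ q (-a) : ℂ) = ∑ a, χ a * (nsmM δ q a : ℂ) := by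
      rw [← hneg]
      refine Finset.sum_congr rfl fun a _ => ?_
      rw [Even.eval_neg χ a he]
    rw [h2]; simp

lemma nsm_sub_summable {f : ℕ → ℝ} (hf : Summable f) {q : ℕ} [NeZero q] (a : ZMod q) :
    Summable fun m : ℕ => f (a.val + q * m) :=
  hf.comp_injective fun x y h => by
    have := NeZero.pos q
    have h' : q * x = q * y := by simpa using h
    exact Nat.eq_of_mul_eq_mul_left this h'

/-- remainder in the residue class sum -/
lemma nsmM_err {δ : ℝ} (hδ : 0 < δ) {q : ℕ} [NeZero q] (a : ZMod q) :
    |nsmM δ q a - nsmu δ a.val| ≤ nsmZ (1 + δ) / q := by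
  have hq : (1:ℝ) ≤ q := by exact_mod_cast NeZero.one_le
  have hs := nsm_sub_summable (nsmu_summable hδ) a
  rw [nsmM, hs.tsum_eq_zero_add]
  simp only [mul_zero, add_zero, add_sub_cancel_left]
  rw [nsmZ, ← tsum_div_const, ← Real.norm_eq_abs]
  refine tsum_of_norm_bounded ((nsm_summable_shift (a := 1 + δ) (by linarith)).div_const _).hasSum fun m => ?_
  refine (nsmu_abs δ _).trans ?_
  have h1 : (q:ℝ) * ((m+1 : ℕ):ℝ) ≤ ((a.val + q * (m+1) : ℕ) : ℝ) := by
    push_cast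
    have : (0:ℝ) ≤ a.val := Nat.cast_nonneg _
    linarith
  have hm : (0:ℝ) < ((m+1:ℕ):ℝ) := by positivity
  calc _ ≤ ((q:ℝ) * ((m+1 : ℕ):ℝ)) ^ (-(1+δ)) :=
        Real.rpow_le_rpow_of_nonpos (by positivity) h1 (by linarith)
    _ = (q:ℝ) ^ (-(1+δ)) * ((m+1 : ℕ):ℝ) ^ (-(1+δ)) := Real.mul_rpow (by positivity) hm.le
    _ ≤ (q:ℝ) ^ (-1 : ℝ) * ((m+1 : ℕ):ℝ) ^ (-(1+δ)) := by
        gcongr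
        linarith
    _ = _ := by rw [Real.rpow_neg_one]; field_simp

lemma nsm_val_sum (q : ℕ) [NeZero q] (g : ℕ → ℝ) : ∑ a : ZMod q, g a.val = ∑ n ∈ Finset.range q, g n := by
  obtain ⟨k, rfl⟩ : ∃ k, q = k + 1 := ⟨q - 1, (Nat.succ_pred_eq_of_ne_zero (NeZero.ne q)).symm⟩
  exact Fin.sum_univ_eq_sum_range g (k+1)

lemma nsm_sum_abs {δ : ℝ} (hδ : 0 < δ) {q : ℕ} [NeZero q] :
    ∑ a : ZMod q, |nsmu δ a.val| ≤ nsmZ (1 + δ) := by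
  rw [nsm_val_sum q (fun n => |nsmu δ n|), ← nsm_z_tsum hδ]
  calc _ ≤ ∑ n ∈ Finset.range q, (n:ℝ) ^ (-(1+δ)) := Finset.sum_le_sum fun n _ => nsmu_abs δ n
    _ ≤ _ := (nsm_z_summable hδ).sum_le_tsum _ fun n _ => by positivity

lemma nsmu_abs_le {δ : ℝ} (hδ : 0 < δ) {n : ℕ} (hn : 1 ≤ n) : |nsmu δ n| ≤ 1 / n := by
  refine (nsmu_abs δ n).trans ?_
  have : (1:ℝ) ≤ n := by exact_mod_cast hn
  rw [one_div, ← Real.rpow_neg_one]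
  exact Real.rpow_le_rpow_of_exponent_le this (by linarith)

lemma nsm_cross {δ : ℝ} (hδ : 0 < δ) {q : ℕ} [NeZero q] {a : ZMod q} (ha : a ≠ 0) :
    |nsmu δ a.val * nsmu δ (-a).val| ≤ 2 / q * (|nsmu δ a.val| + |nsmu δ (-a).val|) := by
  have hq : (1:ℝ) ≤ q := by exact_mod_cast NeZero.one_le
  have h1 : (-a).val = q - a.val := by rw [ZMod.neg_val, if_neg ha]
  have h2 : a.val < q := ZMod.val_lt a
  have h3 : 1 ≤ a.val := Nat.one_le_iff_ne_zero.2 (by rwa [Ne, ZMod.val_eq_zero])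
  have key : ∀ n : ℕ, 1 ≤ n → q ≤ 2 * n → |nsmu δ n| ≤ 2 / q := by
    intro n hn hqn
    refine (nsmu_abs_le hδ hn).trans ?_
    have hn' : (1:ℝ) ≤ n := by exact_mod_cast hn
    have hqn' : (q:ℝ) ≤ 2 * n := by exact_mod_cast hqn
    rw [div_le_div_iff₀ (by linarith) (by linarith)]
    linarith
  have p1 := abs_nonneg (nsmu δ a.val)
  have p2 := abs_nonneg (nsmu δ (-a).val)
  have p3 : 0 ≤ 2 / (q:ℝ) := by positivity
  rw [abs_mul]
  rcases le_total q (2 * a.val) with h | h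
  · have := key a.val h3 h
    nlinarith [mul_le_mul_of_nonneg_right this p2, mul_nonneg p3 p1]
  · have := key (-a).val (by omega) (by omega)
    nlinarith [mul_le_mul_of_nonneg_left this p1, mul_nonneg p3 p2]

lemma nsm_pointwise {r w1 w2 v1 v2 k : ℝ} (h1 : |w1 - v1| ≤ r) (h2 : |w2 - v2| ≤ r)
    (h3 : |v1 * v2| ≤ 2 * k * (|v1| + |v2|)) :
    |((w1 - w2)/2)^2 - (v1^2 + v2^2)/4| ≤ (r + k) * (|v1| + |v2|) + r^2 := by
  obtain ⟨R, hR⟩ : ∃ R, R = (w1 - w2)/2 - (v1 - v2)/2 := ⟨_, rfl⟩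
  have hRr : |R| ≤ r := by
    rw [hR, abs_le]
    rw [abs_le] at h1 h2
    constructor <;> linarith
  have e : ((w1 - w2)/2)^2 - (v1^2 + v2^2)/4 = -(v1 * v2)/2 + (v1 - v2) * R + R^2 := by
    rw [show (w1 - w2)/2 = R + (v1 - v2)/2 by rw [hR]; ring]; ring
  have hr0 : 0 ≤ r := (abs_nonneg _).trans hRr
  have a1 : |-(v1*v2)/2| ≤ k * (|v1| + |v2|) := by
    rw [abs_div, abs_neg, abs_two]; linarith
  have a2 : |(v1 - v2) * R| ≤ (|v1| + |v2|) * r := by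
    rw [abs_mul]
    have := abs_sub v1 v2
    gcongr
  have a3 : |R^2| ≤ r^2 := by
    rw [abs_pow]; gcongr
  rw [e]
  calc _ ≤ |-(v1 * v2)/2 + (v1 - v2) * R| + |R^2| := abs_add_le _ _
    _ ≤ |-(v1 * v2)/2| + |(v1 - v2) * R| + |R^2| := by gcongr; exact abs_add_le _ _
    _ ≤ _ := by linarith

lemma nsm_arith (q : ℝ) (hq : 1 ≤ q) (Z S : ℝ) (hZ : 1 ≤ Z) (hS : S ≤ Z)
    (hS0 : 0 ≤ S) :
    (Z / q + 1 / q) * (S + S) + q * (Z / q) ^ 2 ≤ 5 * Z ^ 2 / q := by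
  calc _ ≤ (Z / q + Z / q) * (Z + Z) + q * (Z / q) ^ 2 := by gcongr
    _ = _ := by field_simp; ring

open scoped Classical in
lemma nsm_MV_abs {q : ℕ} [NeZero q] (w v : ZMod q → ℝ) (Z : ℝ) (hZ : 1 ≤ Z)
    (hv : ∑ a, |v a| ≤ Z) (hw : ∀ a, |w a - v a| ≤ Z / q)
    (hcr : ∀ a, IsUnit a → |v a * v (-a)| ≤ 2 * (1 / (q:ℝ)) * (|v a| + |v (-a)|)) :
    |(∑ a : ZMod q, if IsUnit a then ((w a - w (-a)) / 2) ^ 2 else 0) -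
      (∑ a : ZMod q, if IsUnit a then (v a)^2 else 0) / 2| ≤ 5 * Z ^ 2 / q := by
  have hq : (1:ℝ) ≤ q := by exact_mod_cast NeZero.one_le
  have hneg : ∑ a : ZMod q, (if IsUnit a then (v (-a))^2 else 0) =
      ∑ a : ZMod q, (if IsUnit a then (v a)^2 else 0) := by
    rw [← Equiv.sum_comp (Equiv.neg (ZMod q)) (fun a => if IsUnit a then (v a)^2 else 0)]
    simp
  have hneg2 : ∑ a : ZMod q, |v (-a)| = ∑ a : ZMod q, |v a| :=
    Equiv.sum_comp (Equiv.neg (ZMod q)) (fun a => |v a|)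
  have e1 : (∑ a : ZMod q, if IsUnit a then (v a)^2 else 0) / 2 =
      ∑ a : ZMod q, if IsUnit a then ((v a)^2 + (v (-a))^2)/4 else 0 := by
    have : ∑ a : ZMod q, (if IsUnit a then ((v a)^2 + (v (-a))^2)/4 else 0) =
      (∑ a : ZMod q, (if IsUnit a then (v a)^2 else 0) +
        ∑ a : ZMod q, (if IsUnit a then (v (-a))^2 else 0)) / 4 := by
      rw [← Finset.sum_add_distrib, Finset.sum_div]
      refine Finset.sum_congr rfl fun a _ => ?_
      split_ifs <;> simp
    rw [this, hneg]; ring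
  rw [e1, ← Finset.sum_sub_distrib]
  refine (Finset.abs_sum_le_sum_abs _ _).trans ?_
  calc _ ≤ ∑ a : ZMod q, ((Z / q + 1 / q) * (|v a| + |v (-a)|) + (Z / q) ^ 2) := by
        refine Finset.sum_le_sum fun a _ => ?_
        split_ifs with ha
        · exact nsm_pointwise (hw a) (hw (-a)) (hcr a ha)
        · simp only [sub_self, abs_zero]
          positivity
    _ = (Z / q + 1 / q) * (∑ a : ZMod q, |v a| + ∑ a : ZMod q, |v a|) +
        q * (Z / q) ^ 2 := by
        rw [Finset.sum_add_distrib, ← Finset.mul_sum, Finset.sum_add_distrib, hneg2]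
        rw [Finset.sum_const, Finset.card_univ, ZMod.card, nsmul_eq_mul]
    _ ≤ 5 * Z ^ 2 / q := nsm_arith q hq Z _ hZ hv (Finset.sum_nonneg fun _ _ => abs_nonneg _)

open scoped Classical in
lemma nsm_MV {δ : ℝ} (hδ : 0 < δ) {q : ℕ} [NeZero q] (hq2 : 2 ≤ q) :
    |(∑ a : ZMod q, if IsUnit a then ((nsmM δ q a - nsmM δ q (-a)) / 2) ^ 2 else 0) -
      (∑ a : ZMod q, if IsUnit a then (nsmu δ a.val)^2 else 0) / 2| ≤ 5 * nsmZ (1 + δ) ^ 2 / q := by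
  refine nsm_MV_abs (fun a => nsmM δ q a) (fun a => nsmu δ a.val) (nsmZ (1 + δ))
    (nsmZ_one_le (a := 1 + δ) (by linarith)) (nsm_sum_abs hδ) (fun a => nsmM_err hδ a) ?_
  intro a ha
  have ha0 : a ≠ 0 := by
    rintro rfl
    have : Fact (1 < q) := ⟨by omega⟩
    exact not_isUnit_zero ha
  have h := nsm_cross hδ ha0
  have e : 2 * (1 / (q:ℝ)) = 2 / q := by ring
  rw [e]
  exact h

/-- the diagonal coefficients -/
noncomputable def nsmf (q : ℕ) (n : ℕ) : ℝ :=
  if n.Coprime q then (ArithmeticFunction.moebius n : ℝ) ^ 2 * ((n:ℝ) ^ 2)⁻¹ else 0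

lemma nsm_mu_sq (n : ℕ) : (ArithmeticFunction.moebius n : ℝ) ^ 2 ≤ 1 := by
  have : |(ArithmeticFunction.moebius n : ℝ)| ≤ 1 := by
    exact_mod_cast ArithmeticFunction.abs_moebius_le_one (n := n)
  rw [← sq_abs]; exact pow_le_one₀ (abs_nonneg _) this

lemma nsmf_nonneg (q n : ℕ) : 0 ≤ nsmf q n := by
  unfold nsmf; split_ifs <;> positivity

lemma nsmf_le (q n : ℕ) : nsmf q n ≤ ((n:ℝ) ^ 2)⁻¹ := by
  unfold nsmf
  split_ifs
  · have := nsm_mu_sq n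
    calc _ ≤ 1 * ((n:ℝ) ^ 2)⁻¹ := by gcongr
      _ = _ := one_mul _
  · positivity

lemma nsmf_summable (q : ℕ) : Summable (nsmf q) :=
  Summable.of_nonneg_of_le (nsmf_nonneg q) (nsmf_le q) (Real.summable_nat_pow_inv.2 (by norm_num))

lemma nsmf_tsum_one_le (q : ℕ) : 1 ≤ ∑' n, nsmf q n := by
  have := (nsmf_summable q).le_tsum 1 fun n _ => nsmf_nonneg q n
  simpa [nsmf] using this

lemma nsm_diag_pt {δ : ℝ} (hδ : 0 < δ) {q : ℕ} [NeZero q] (n : ℕ) :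
    |(if n < q then (if n.Coprime q then (nsmu δ n)^2 else 0) else 0) - nsmf q n| ≤
      (4 * δ + (q:ℝ) ^ (-(1/2) : ℝ)) * (n:ℝ) ^ (-(1 + 1/2) : ℝ) := by
  rcases Nat.eq_zero_or_pos n with rfl | hn
  · have h0 : nsmf q 0 = 0 := by simp [nsmf]
    rw [h0, show nsmu δ 0 = 0 by simp [nsmu]]
    have : (0:ℝ) ≤ (4 * δ + (q:ℝ) ^ (-(1/2) : ℝ)) * ((0:ℕ):ℝ) ^ (-(1 + 1/2) : ℝ) := by positivity
    simpa using this
  have hq : (1:ℝ) ≤ q := by exact_mod_cast NeZero.one_le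
  have hn1 : (1:ℝ) ≤ n := by exact_mod_cast hn
  have hn0 : (0:ℝ) < n := by linarith
  have hmu := nsm_mu_sq n
  have esq : ((n:ℝ) ^ 2)⁻¹ = (n:ℝ) ^ (-(1 + 1/2) : ℝ) * (n:ℝ) ^ (-(1/2) : ℝ) := by
    rw [← Real.rpow_add hn0, ← Real.rpow_natCast, ← Real.rpow_neg hn0.le]; norm_num
  have hY : 0 < (n:ℝ) ^ (-(1 + 1/2) : ℝ) := by positivity
  by_cases hc : n.Coprime q
  · simp only [nsmf, if_pos hc]
    by_cases hlt : n < q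
    · simp only [hlt, if_true]
      have e1 : (nsmu δ n)^2 = (ArithmeticFunction.moebius n : ℝ) ^ 2 * ((n:ℝ) ^ 2)⁻¹ * (n:ℝ) ^ (-(2*δ)) := by
        unfold nsmu
        rw [mul_pow, mul_assoc]
        congr 1
        rw [← Real.rpow_natCast, ← Real.rpow_natCast, ← Real.rpow_mul hn0.le, ← Real.rpow_neg hn0.le,
          ← Real.rpow_add hn0]
        congr 1; push_cast; ring
      have e2 : 1 - (n:ℝ) ^ (-(2*δ)) ≤ 4 * δ * (n:ℝ) ^ (1/2 : ℝ) := by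
        have h1 := Real.log_le_rpow_div hn0.le (ε := 1/2) (by norm_num)
        rw [Real.rpow_def_of_pos hn0]
        have h2 := Real.add_one_le_exp (Real.log n * (-(2*δ)))
        have h3 : Real.log n * (2 * δ) ≤ (n:ℝ) ^ (1/2 : ℝ) / (1/2) * (2 * δ) := by gcongr
        linarith
      have e3 : (n:ℝ) ^ (-(2*δ)) ≤ 1 := Real.rpow_le_one_of_one_le_of_nonpos hn1 (by linarith)
      rw [e1, abs_sub_comm, abs_of_nonneg (by
        have : 0 ≤ (ArithmeticFunction.moebius n : ℝ) ^ 2 * ((n:ℝ) ^ 2)⁻¹ := by positivity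
        nlinarith)]
      calc _ = (ArithmeticFunction.moebius n : ℝ) ^ 2 * (((n:ℝ) ^ 2)⁻¹ * (1 - (n:ℝ) ^ (-(2*δ)))) := by ring
        _ ≤ 1 * (((n:ℝ) ^ 2)⁻¹ * (4 * δ * (n:ℝ) ^ (1/2 : ℝ))) := by
            have : 0 ≤ 1 - (n:ℝ) ^ (-(2*δ)) := by linarith
            gcongr
        _ = 4 * δ * (n:ℝ) ^ (-(1 + 1/2) : ℝ) := by
            rw [esq, Real.rpow_neg hn0.le (1/2)]
            field_simp
        _ ≤ _ := by
            gcongr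
            have : 0 < (q:ℝ) ^ (-(1/2) : ℝ) := by positivity
            linarith
    · simp only [hlt, if_false, zero_sub, abs_neg]
      rw [abs_of_nonneg (by positivity)]
      have hqn : (q:ℝ) ≤ n := by exact_mod_cast not_lt.1 hlt
      calc _ ≤ 1 * ((n:ℝ) ^ 2)⁻¹ := by gcongr
        _ = (n:ℝ) ^ (-(1/2) : ℝ) * (n:ℝ) ^ (-(1 + 1/2) : ℝ) := by rw [esq]; ring
        _ ≤ (q:ℝ) ^ (-(1/2) : ℝ) * (n:ℝ) ^ (-(1 + 1/2) : ℝ) := by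
            have := Real.rpow_le_rpow_of_nonpos (by linarith) hqn (show (-(1/2):ℝ) ≤ 0 by norm_num)
            gcongr
        _ ≤ _ := by gcongr; linarith
  · simp only [nsmf, if_neg hc, ite_self, sub_self, abs_zero]
    positivity

open scoped Classical in
lemma nsm_diag {δ : ℝ} (hδ : 0 < δ) {q : ℕ} [NeZero q] :
    |(∑ a : ZMod q, if IsUnit a then (nsmu δ a.val)^2 else 0) - ∑' n, nsmf q n| ≤
      (4 * δ + (q:ℝ) ^ (-(1/2) : ℝ)) * nsmZ (1 + 1/2) := by
  have e1 : (∑ a : ZMod q, if IsUnit a then (nsmu δ a.val)^2 else 0) =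
      ∑ n ∈ Finset.range q, (if n < q then (if n.Coprime q then (nsmu δ n)^2 else 0) else 0) := by
    rw [← nsm_val_sum q (fun n => if n < q then (if n.Coprime q then (nsmu δ n)^2 else 0) else 0)]
    refine Finset.sum_congr rfl fun a _ => ?_
    have : IsUnit a ↔ a.val.Coprime q := by
      rw [← ZMod.isUnit_iff_coprime, ZMod.natCast_zmod_val]
    simp [this, ZMod.val_lt a]
  have hs : HasSum (fun n : ℕ => (if n < q then (if n.Coprime q then (nsmu δ n)^2 else 0) else 0))
      (∑ a : ZMod q, if IsUnit a then (nsmu δ a.val)^2 else 0) := by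
    rw [e1]
    refine hasSum_sum_of_ne_finset_zero fun n hn => ?_
    rw [Finset.mem_range] at hn
    rw [if_neg hn]
  have h1 := hs.sub (nsmf_summable q).hasSum
  have h2 := ((nsm_z_summable (δ := 1/2) (by norm_num)).mul_left (4 * δ + (q:ℝ) ^ (-(1/2) : ℝ))).hasSum
  rw [tsum_mul_left, nsm_z_tsum (by norm_num)] at h2
  rw [← h1.tsum_eq, ← Real.norm_eq_abs]
  exact tsum_of_norm_bounded h2 fun n => nsm_diag_pt hδ n

lemma nsmf_mul (q : ℕ) {m n : ℕ} (h : m.Coprime n) : nsmf q (m * n) = nsmf q m * nsmf q n := by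
  unfold nsmf
  have hiff : (m * n).Coprime q ↔ m.Coprime q ∧ n.Coprime q := Nat.coprime_mul_iff_left
  by_cases h1 : m.Coprime q
  · by_cases h2 : n.Coprime q
    · rw [if_pos (hiff.2 ⟨h1, h2⟩), if_pos h1, if_pos h2,
        ArithmeticFunction.isMultiplicative_moebius.map_mul_of_coprime h]
      push_cast
      rw [mul_pow, mul_pow, mul_inv]; ring
    · rw [if_neg (fun h => h2 (hiff.1 h).2), if_neg h2, mul_zero]
  · rw [if_neg (fun h => h1 (hiff.1 h).1), if_neg h1, zero_mul]

lemma nsmf_prime (q : ℕ) {p : ℕ} (hp : p.Prime) :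
    ∑' e : ℕ, nsmf q (p ^ e) = 1 + nsmf q p := by
  have h : ∀ e ∉ Finset.range 2, nsmf q (p ^ e) = 0 := by
    intro e he
    rw [Finset.mem_range, not_lt] at he
    have : ArithmeticFunction.moebius (p ^ e) = 0 := by
      rw [ArithmeticFunction.moebius_apply_prime_pow hp (by omega), if_neg (by omega)]
    unfold nsmf
    rw [this]; simp
  rw [tsum_eq_sum h]
  simp [Finset.sum_range_succ, nsmf]

lemma nsmf_at_prime (q : ℕ) {p : ℕ} (hp : p.Prime) :
    nsmf q p = if p ∣ q then 0 else ((p:ℝ)^2)⁻¹ := by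
  unfold nsmf
  rw [ArithmeticFunction.moebius_apply_prime hp]
  have hiff := hp.coprime_iff_not_dvd (n := q)
  by_cases h : p ∣ q
  · rw [if_pos h, if_neg (fun h' => hiff.1 h' h)]
  · rw [if_neg h, if_pos (hiff.2 h)]; norm_num

lemma nsm_finprod (q : ℕ) (hq : q ≠ 0) :
    HasProd (fun p : {p : ℕ // p.Prime} => ((if (p:ℕ) ∣ q then (1 + (((p:ℕ):ℝ)^2)⁻¹) else 1 : ℝ) : ℂ))
      ((∏ p ∈ q.primeFactors, (1 + ((p:ℝ)^2)⁻¹) : ℝ) : ℂ) := by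
  have h := hasProd_prod_of_ne_finset_one (L := .unconditional _)
      (f := fun p : {p : ℕ // p.Prime} => ((if (p:ℕ) ∣ q then (1 + (((p:ℕ):ℝ)^2)⁻¹) else 1 : ℝ) : ℂ))
      (s := q.primeFactors.subtype Nat.Prime) (by
        intro p hp
        rw [Finset.mem_subtype, Nat.mem_primeFactors] at hp
        rw [if_neg (fun hd => hp ⟨p.2, hd, hq⟩)]; simp)
  convert h using 1
  rw [Finset.prod_subtype_of_mem (fun p : ℕ => ((if p ∣ q then (1 + ((p:ℝ)^2)⁻¹) else 1 : ℝ) : ℂ))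
      (fun x hx => Nat.prime_of_mem_primeFactors hx)]
  rw [Complex.ofReal_prod]
  refine Finset.prod_congr rfl fun p hp => ?_
  rw [if_pos (Nat.dvd_of_mem_primeFactors hp)]

lemma nsm_euler (q : ℕ) (hq : q ≠ 0) :
    ((∑' n, nsmf q n : ℝ) : ℂ) * ((∏ p ∈ q.primeFactors, (1 + ((p:ℝ)^2)⁻¹) : ℝ) : ℂ) * riemannZeta 4 =
      riemannZeta 2 := by
  have h1 : HasProd (fun p : Nat.Primes => (((1 + nsmf q p : ℝ)) : ℂ)) ((∑' n, nsmf q n : ℝ) : ℂ) := by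
    have h := EulerProduct.eulerProduct_hasProd (f := nsmf q) (by simp [nsmf]) (nsmf_mul q)
      (nsmf_summable q).norm (by simp [nsmf])
    have h' : HasProd (fun p : Nat.Primes => (1 + nsmf q p : ℝ)) (∑' n, nsmf q n : ℝ) := by
      have e : (fun p : Nat.Primes => ∑' e : ℕ, nsmf q ((p:ℕ) ^ e)) = fun p : Nat.Primes => 1 + nsmf q p :=
        funext fun p => nsmf_prime q p.2
      rw [e] at h
      exact h
    exact h'.map Complex.ofRealHom Complex.continuous_ofReal
  have h2 : HasProd (fun p : Nat.Primes => ((if (p:ℕ) ∣ q then (1 + (((p:ℕ):ℝ)^2)⁻¹) else 1 : ℝ) : ℂ))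
      ((∏ p ∈ q.primeFactors, (1 + ((p:ℝ)^2)⁻¹) : ℝ) : ℂ) := nsm_finprod q hq
  have h3 := riemannZeta_eulerProduct_hasProd (s := 4) (by norm_num)
  have h4 := riemannZeta_eulerProduct_hasProd (s := 2) (by norm_num)
  refine ((h1.mul h2).mul h3).unique ?_
  convert h4 using 2 with p
  have hp := p.2
  have hp2 : (2:ℝ) ≤ (p:ℕ) := by exact_mod_cast hp.two_le
  set x : ℝ := (((p:ℕ):ℝ)^2)⁻¹ with hx
  have hx1 : x < 1 := by
    rw [hx]; apply inv_lt_one_of_one_lt₀; nlinarith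
  have hx0 : 0 < x := by rw [hx]; positivity
  have c2 : (((p:ℕ):ℂ)) ^ (-(2:ℂ)) = (x:ℂ) := by
    rw [Complex.cpow_neg, hx]; push_cast
    rw [show (2:ℂ) = ((2:ℕ):ℂ) by norm_num, Complex.cpow_natCast]
  have c4 : (((p:ℕ):ℂ)) ^ (-(4:ℂ)) = ((x^2 : ℝ):ℂ) := by
    rw [Complex.cpow_neg, hx]; push_cast
    rw [show (4:ℂ) = ((4:ℕ):ℂ) by norm_num, Complex.cpow_natCast, inv_pow, ← pow_mul]
  rw [c2, c4, nsmf_at_prime q hp, ← hx]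
  have e : (1 + if (p:ℕ) ∣ q then 0 else x) * (if (p:ℕ) ∣ q then 1 + x else 1) = 1 + x := by
    split_ifs <;> ring
  rw [← Complex.ofReal_mul, e]
  norm_cast
  have : 1 - x ≠ 0 := by linarith
  have : 1 - x^2 ≠ 0 := by nlinarith
  rw [mul_inv_eq_iff_eq_mul₀ this, eq_comm, inv_mul_eq_iff_eq_mul₀ (by assumption)]
  ring

lemma nsm_main_eq (q : ℕ) (hq : q ≠ 0) :
    (riemannZeta 2 / (2 * riemannZeta 4)).re * (∏ p ∈ q.primeFactors, (1 + ((p : ℝ) ^ 2)⁻¹)⁻¹) =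
      (∑' n, nsmf q n) / 2 := by
  have h4 : riemannZeta 4 ≠ 0 := riemannZeta_ne_zero_of_one_lt_re (by norm_num)
  rw [← nsm_euler q hq, Finset.prod_inv_distrib]
  set P := ∏ p ∈ q.primeFactors, (1 + ((p : ℝ) ^ 2)⁻¹) with hP
  have hP0 : 0 < P := Finset.prod_pos fun p _ => by positivity
  rw [show (((∑' n, nsmf q n : ℝ) : ℂ) * (P : ℂ) * riemannZeta 4 / (2 * riemannZeta 4)) =
    (((∑' n, nsmf q n) * P / 2 : ℝ) : ℂ) by push_cast; field_simp, Complex.ofReal_re]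
  field_simp

lemma nsm_inv_close {A B : ℂ} {η : ℝ} (hA : A ≠ 0) (hB : B ≠ 0) (h : ‖B - A‖ ≤ η * ‖A‖) :
    |1 / ‖A‖ ^ 2 - 1 / ‖B‖ ^ 2| ≤ (2 * η + η ^ 2) * (1 / ‖B‖ ^ 2) := by
  have ha : 0 < ‖A‖ := norm_pos_iff.2 hA
  have hb : 0 < ‖B‖ := norm_pos_iff.2 hB
  have h' : |‖B‖ - ‖A‖| ≤ η * ‖A‖ := (abs_norm_sub_norm_le B A).trans h
  set r := ‖B‖ / ‖A‖ with hr
  have hr0 : 0 < r := div_pos hb ha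
  have h1 : |r - 1| ≤ η := by
    rw [hr, div_sub_one ha.ne', abs_div, abs_of_pos ha, div_le_iff₀ ha]; exact h'
  have e : 1 / ‖A‖ ^ 2 - 1 / ‖B‖ ^ 2 = (r ^ 2 - 1) * (1 / ‖B‖ ^ 2) := by
    rw [hr]; field_simp
  rw [e, abs_mul, abs_of_pos (show 0 < 1 / ‖B‖ ^ 2 by positivity)]
  refine mul_le_mul_of_nonneg_right ?_ (by positivity)
  have h2 := abs_le.1 h1
  rw [abs_le]; constructor <;> nlinarith

open scoped Classical in
lemma nsm_ST {q : ℕ} [NeZero q] {δ η : ℝ} (hδ : 0 < δ)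
    (h : ∀ χ : DirichletCharacter ℂ q, χ ≠ 1 →
      χ.LFunction 1 ≠ 0 ∧ ‖χ.LFunction (1 + δ) - χ.LFunction 1‖ ≤ η * ‖χ.LFunction 1‖) :
    |(∑ χ : DirichletCharacter ℂ q, if χ.Odd then 1 / ‖χ.LFunction 1‖ ^ 2 else 0) -
      (∑ χ : DirichletCharacter ℂ q, if χ.Odd then 1 / ‖χ.LFunction (1 + δ)‖ ^ 2 else 0)| ≤
    (2 * η + η ^ 2) * (∑ χ : DirichletCharacter ℂ q, if χ.Odd then 1 / ‖χ.LFunction (1 + δ)‖ ^ 2 else 0) := by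
  rw [← Finset.sum_sub_distrib, Finset.mul_sum]
  refine (Finset.abs_sum_le_sum_abs _ _).trans (Finset.sum_le_sum fun χ _ => ?_)
  by_cases ho : χ.Odd
  · rw [if_pos ho, if_pos ho]
    have hne : χ ≠ 1 := by
      rintro rfl
      have h1 : (1 : DirichletCharacter ℂ q) (-1) = -1 := ho
      rw [MulChar.one_apply isUnit_one.neg] at h1
      norm_num at h1
    refine nsm_inv_close (h χ hne).1 ?_ (h χ hne).2
    refine LFunction_ne_zero_of_one_le_re χ (Or.inl hne) ?_
    simp [hδ.le]
  · simp [if_neg ho]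

lemma nsm_tendsto_rpow {a : ℝ} (ha : 0 < a) :
    Filter.Tendsto (fun q : ℕ => (q:ℝ) ^ (-a)) Filter.atTop (nhds 0) :=
  (tendsto_rpow_neg_atTop ha).comp tendsto_natCast_atTop_atTop

open scoped Classical in
lemma nsm_TM {q : ℕ} [NeZero q] (hq : 2 ≤ q) :
    |(∑ χ : DirichletCharacter ℂ q, if χ.Odd then
        1 / ‖χ.LFunction (1 + (((q:ℝ) ^ (-(2/5):ℝ) : ℝ) : ℂ))‖ ^ 2 else 0) -
      (∑' n, nsmf q n) / 2 * q.totient| ≤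
    (20 * (q:ℝ) ^ (-(1/5):ℝ) + (1/2) * ((4 * (q:ℝ) ^ (-(2/5):ℝ) + (q:ℝ) ^ (-(1/2):ℝ)) * nsmZ (1 + 1/2))) *
      q.totient := by
  have hq0 : (0:ℝ) < q := by positivity
  have hq1 : (1:ℝ) ≤ q := by exact_mod_cast (by omega : 1 ≤ q)
  have hδ : 0 < (q:ℝ) ^ (-(2/5):ℝ) := Real.rpow_pos_of_pos hq0 _
  have hδ1 : (q:ℝ) ^ (-(2/5):ℝ) ≤ 1 := Real.rpow_le_one_of_one_le_of_nonpos hq1 (by norm_num)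
  rw [nsm_T_eq hδ]
  have hMV := nsm_MV (q := q) hδ hq
  have hD := nsm_diag (q := q) hδ
  have hZ := nsmZ_le hδ
  have hZ0 : 0 ≤ nsmZ (1 + (q:ℝ) ^ (-(2/5):ℝ)) := by
    have := nsmZ_one_le (a := 1 + (q:ℝ) ^ (-(2/5):ℝ)) (by linarith)
    linarith
  have hinv : 1 / (q:ℝ) ^ (-(2/5):ℝ) = (q:ℝ) ^ ((2/5):ℝ) := by
    rw [Real.rpow_neg hq0.le, one_div, inv_inv]
  have hge : 1 ≤ (q:ℝ) ^ ((2/5):ℝ) := Real.one_le_rpow hq1 (by norm_num)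
  have hZ2 : nsmZ (1 + (q:ℝ) ^ (-(2/5):ℝ)) ≤ 2 * (q:ℝ) ^ ((2/5):ℝ) := by
    rw [hinv] at hZ; linarith
  have hB : 5 * nsmZ (1 + (q:ℝ) ^ (-(2/5):ℝ)) ^ 2 / q ≤ 20 * (q:ℝ) ^ (-(1/5):ℝ) := by
    rw [div_le_iff₀ hq0, mul_assoc, show (q:ℝ) ^ (-(1/5):ℝ) * q = ((q:ℝ) ^ ((2/5):ℝ)) ^ 2 by
      rw [← Real.rpow_natCast, ← Real.rpow_mul hq0.le]
      nth_rewrite 2 [← Real.rpow_one (q:ℝ)]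
      rw [← Real.rpow_add hq0]; norm_num]
    have := pow_le_pow_left₀ hZ0 hZ2 2
    nlinarith
  have hφ : (0:ℝ) ≤ q.totient := by positivity
  rw [mul_comm (q.totient : ℝ), ← sub_mul, abs_mul, abs_of_nonneg hφ]
  refine mul_le_mul_of_nonneg_right ?_ hφ
  rw [abs_le] at *
  constructor <;> linarith [hMV.1, hMV.2, hD.1, hD.2]

open scoped Classical in
lemma nsm_final : ∀ ε > (0:ℝ), ∃ Q : ℕ, ∀ (q : ℕ) [NeZero q], Q ≤ q →
    |(∑ χ : DirichletCharacter ℂ q, if χ.Odd then 1 / ‖χ.LFunction 1‖ ^ 2 else 0) -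
      (∑' n, nsmf q n) / 2 * q.totient| ≤ ε * ((∑' n, nsmf q n) / 2 * q.totient) := by
  intro ε hε
  obtain ⟨C, hC1, hC⟩ := nsm_L_bounds (1/10) (by norm_num) (by norm_num)
  obtain ⟨c, hc0, hc⟩ := nsm_lower
  let e1 : ℕ → ℝ := fun q => 2 * (C / c * (q:ℝ) ^ (-(1/20):ℝ)) + (C / c * (q:ℝ) ^ (-(1/20):ℝ)) ^ 2
  let e2 : ℕ → ℝ := fun q =>
    20 * (q:ℝ) ^ (-(1/5):ℝ) + (1/2) * ((4 * (q:ℝ) ^ (-(2/5):ℝ) + (q:ℝ) ^ (-(1/2):ℝ)) * nsmZ (1 + 1/2))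
  have t0 := (nsm_tendsto_rpow (a := 1/20) (by norm_num)).const_mul (C / c)
  have t1 : Filter.Tendsto e1 Filter.atTop (nhds 0) := by
    have := (t0.const_mul 2).add (t0.pow 2)
    simpa [e1] using this
  have t2 : Filter.Tendsto e2 Filter.atTop (nhds 0) := by
    have := ((nsm_tendsto_rpow (a := 1/5) (by norm_num)).const_mul 20).add
      (((((nsm_tendsto_rpow (a := 2/5) (by norm_num)).const_mul 4).add
      (nsm_tendsto_rpow (a := 1/2) (by norm_num))).mul_const (nsmZ (1 + 1/2))).const_mul (1/2))
    simpa [e2] using this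
  have t3 : Filter.Tendsto (fun q => e1 q * (1 + 2 * e2 q) + 2 * e2 q) Filter.atTop (nhds 0) := by
    have := (t1.mul ((t2.const_mul 2).const_add 1)).add (t2.const_mul 2)
    simpa using this
  obtain ⟨Q, hQ⟩ := Filter.eventually_atTop.1 (t3.eventually_le_const hε)
  refine ⟨max Q 2, fun q _ hq => ?_⟩
  have hq2 : 2 ≤ q := (le_max_right _ _).trans hq
  have hqε := hQ q ((le_max_left _ _).trans hq)
  have hq0 : (0:ℝ) < q := by positivity
  have hq1 : (1:ℝ) ≤ q := by exact_mod_cast (by omega : 1 ≤ q)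
  have hδ : 0 < (q:ℝ) ^ (-(2/5):ℝ) := Real.rpow_pos_of_pos hq0 _
  have hδ1 : (q:ℝ) ^ (-(2/5):ℝ) ≤ 1 := Real.rpow_le_one_of_one_le_of_nonpos hq1 (by norm_num)
  have hST := nsm_ST (q := q) (δ := (q:ℝ) ^ (-(2/5):ℝ)) (η := C / c * (q:ℝ) ^ (-(1/20):ℝ)) hδ (by
    intro χ hχ
    have hl := hc q χ hχ
    have hpos : 0 < c * (q:ℝ) ^ (-(1/4):ℝ) := mul_pos hc0 (Real.rpow_pos_of_pos hq0 _)
    refine ⟨norm_pos_iff.1 (hpos.trans_le hl), ?_⟩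
    refine (hC q χ hχ _ hδ.le hδ1).2.trans ?_
    calc C * (q:ℝ) ^ (1/10:ℝ) * (q:ℝ) ^ (-(2/5):ℝ)
        = C / c * (q:ℝ) ^ (-(1/20):ℝ) * (c * (q:ℝ) ^ (-(1/4):ℝ)) := by
          rw [mul_assoc, ← Real.rpow_add hq0, show C / c * (q:ℝ) ^ (-(1/20):ℝ) * (c * (q:ℝ) ^ (-(1/4):ℝ)) =
            C * ((q:ℝ) ^ (-(1/20):ℝ) * (q:ℝ) ^ (-(1/4):ℝ)) by field_simp, ← Real.rpow_add hq0]
          norm_num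
      _ ≤ _ := mul_le_mul_of_nonneg_left hl (by positivity))
  have hTM := nsm_TM (q := q) hq2
  have hD := nsmf_tsum_one_le q
  set D := ∑' n, nsmf q n
  set T := (∑ χ : DirichletCharacter ℂ q, if χ.Odd then
        1 / ‖χ.LFunction (1 + (((q:ℝ) ^ (-(2/5):ℝ) : ℝ) : ℂ))‖ ^ 2 else 0)
  set S := (∑ χ : DirichletCharacter ℂ q, if χ.Odd then 1 / ‖χ.LFunction 1‖ ^ 2 else 0)
  change |S - T| ≤ e1 q * T at hST
  change |T - _| ≤ e2 q * _ at hTM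
  have hφ : (0:ℝ) ≤ q.totient := by positivity
  set M := D / 2 * q.totient with hM
  have hφM : (q.totient:ℝ) ≤ 2 * M := by rw [hM]; nlinarith
  have hM0 : 0 ≤ M := by linarith
  have he1 : 0 ≤ e1 q := by
    have : 0 ≤ C / c * (q:ℝ) ^ (-(1/20):ℝ) := by positivity
    simp only [e1]; positivity
  have hZ0 : 0 ≤ nsmZ (1 + 1/2) := by
    have := nsmZ_one_le (a := 1 + 1/2) (by norm_num)
    linarith
  have he2 : 0 ≤ e2 q := by
    simp only [e2]; positivity
  have hTM2 : |T - M| ≤ 2 * e2 q * M := hTM.trans (by nlinarith)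
  have hT : T ≤ (1 + 2 * e2 q) * M := by nlinarith [(abs_le.1 hTM2).2]
  calc |S - M| ≤ |S - T| + |T - M| := abs_sub_le _ _ _
    _ ≤ e1 q * T + 2 * e2 q * M := add_le_add hST hTM2
    _ ≤ e1 q * ((1 + 2 * e2 q) * M) + 2 * e2 q * M := by gcongr
    _ = (e1 q * (1 + 2 * e2 q) + 2 * e2 q) * M := by ring
    _ ≤ ε * M := by gcongr

open scoped Classical in
/-- As `q → ∞`, the negative square moment of `L(1,χ)` over odd Dirichlet
characters mod `q` is asymptotic to `(ζ(2)/(2ζ(4))) ∏_{p ∣ q} (1+p⁻²)⁻¹ φ(q)`, i.e.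
`Σ_{χ odd} |L(1,χ)|⁻² = (ζ(2)/(2ζ(4))) ∏_{p ∣ q} (1+p⁻²)⁻¹ φ(q) (1 + o(1))`. -/
theorem negative_square_moment_odd_asymptotic :
    ∀ ε > (0 : ℝ), ∃ Q : ℕ, ∀ (q : ℕ) [NeZero q], Q ≤ q →
      |(∑ χ : DirichletCharacter ℂ q,
          if χ.Odd then 1 / ‖χ.LFunction 1‖ ^ 2 else 0) -
        (riemannZeta 2 / (2 * riemannZeta 4)).re *
          (∏ p ∈ q.primeFactors, (1 + ((p : ℝ) ^ 2)⁻¹)⁻¹) * q.totient| ≤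
      ε * ((riemannZeta 2 / (2 * riemannZeta 4)).re *
          (∏ p ∈ q.primeFactors, (1 + ((p : ℝ) ^ 2)⁻¹)⁻¹) * q.totient) := by
  intro ε hε
  obtain ⟨Q, hQ⟩ := nsm_final ε hε
  refine ⟨Q, fun q _ hq => ?_⟩
  rw [nsm_main_eq q (NeZero.ne q)]
  exact hQ q hq
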